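/- arXiv:2305.11836 — 6 statements merged into one kernel-verified Lean document; each statement's English description precedes it below -/
import Mathlib

section
/- Kelvin transform identity for the fractional Laplacian (footnote 1). Let N ≥ 2, α ∈ (0,1), and let u : ℝ^N → ℝ be a C² function with compact support contained in ℝ^N ∖ {0}. Define the Kelvin transform ū(x) = |x|^{2α−N} u(x/|x|²) for x ≠ 0 and ū(0) = 0. Then for every x ≠ 0 the functions y ↦ δ(ū, x, y) |y|^{−(N+2α)} and y ↦ δ(u, x/|x|², y) |y|^{−(N+2α)} are both Lebesgue integrable on ℝ^N, and ∫_{ℝ^N} δ(ū, x, y) |y|^{−(N+2α)} dy = |x|^{−(N+2α)} ∫_{ℝ^N} δ(u, x/|x|², y) |y|^{−(N+2α)} dy. -/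
open MeasureTheory Classical

/-- The nonlocal second difference `δ(u,x,y) = u(x+y) + u(x-y) - 2u(x)`. -/
noncomputable def nlD {N : ℕ} (u : EuclideanSpace ℝ (Fin N) → ℝ)
    (x y : EuclideanSpace ℝ (Fin N)) : ℝ :=
  u (x + y) + u (x - y) - 2 * u x

/-- The Kelvin transform `ū(x) = |x|^{2α-N} u(x/|x|²)`, with `ū(0) = 0`. -/
noncomputable def kelvin {N : ℕ} (α : ℝ) (u : EuclideanSpace ℝ (Fin N) → ℝ)
    (x : EuclideanSpace ℝ (Fin N)) : ℝ :=
  if x = 0 then 0 else ‖x‖ ^ (2 * α - (N : ℝ)) * u ((‖x‖ ^ 2)⁻¹ • x)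

/-- Shorthand for the Euclidean space. -/
abbrev KE (N : ℕ) := EuclideanSpace ℝ (Fin N)

/-- The conformally invariant cutoff weight. -/
noncomputable def kw {N : ℕ} (ε : ℝ) (x z : KE N) : ℝ :=
  ‖z - x‖ ^ 2 / (‖z - x‖ ^ 2 + ε * (‖z‖ * ‖x‖))

/-- The regularised integrand. -/
noncomputable def kF {N : ℕ} (e ε : ℝ) (f : KE N → ℝ) (x z : KE N) : ℝ :=
  (f z - f x) * kw ε x z * ‖z - x‖ ^ (-e)

theorem kdet {N : ℕ} (c : ℝ) (K : Submodule ℝ (KE N)) :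
    |(c ^ 2 • ((K.reflection : KE N ≃L[ℝ] KE N) : KE N →L[ℝ] KE N)).det| = (c ^ 2) ^ N := by
  have h1 : (c ^ 2 • ((K.reflection : KE N ≃L[ℝ] KE N) : KE N →L[ℝ] KE N)).det
      = LinearMap.det (c ^ 2 • K.reflection.toLinearMap) := rfl
  rw [h1, LinearMap.det_smul, Submodule.det_reflection]
  simp [abs_mul]

theorem kimg {N : ℕ} {R : ℝ} (hR : R ≠ 0) :
    EuclideanGeometry.inversion (0 : KE N) R '' {0}ᶜ = {0}ᶜ := by
  ext z
  simp only [Set.mem_image, Set.mem_compl_iff, Set.mem_singleton_iff]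
  constructor
  · rintro ⟨w, hw, rfl⟩ h
    exact hw ((EuclideanGeometry.inversion_eq_center hR).1 h)
  · intro hz
    refine ⟨EuclideanGeometry.inversion 0 R z, fun h => hz ((EuclideanGeometry.inversion_eq_center hR).1 h), EuclideanGeometry.inversion_inversion _ hR _⟩

theorem kcov {N : ℕ} (hN : 2 ≤ N) {R : ℝ} (hR : R ≠ 0) (G : KE N → ℝ) :
    (Integrable G ↔ Integrable (fun z => ((R / ‖z‖) ^ 2) ^ N * G (EuclideanGeometry.inversion 0 R z))) ∧
    ∫ z, G z = ∫ z, ((R / ‖z‖) ^ 2) ^ N * G (EuclideanGeometry.inversion 0 R z) := by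
  have : Nonempty (Fin N) := ⟨⟨0, by omega⟩⟩
  have hs : MeasurableSet ({0}ᶜ : Set (KE N)) := (measurableSet_singleton 0).compl
  have hd : ∀ z ∈ ({0}ᶜ : Set (KE N)), HasFDerivWithinAt (EuclideanGeometry.inversion (0 : KE N) R)
      ((R / dist z 0) ^ 2 • (((ℝ ∙ (z - 0))ᗮ.reflection : KE N ≃L[ℝ] KE N) : KE N →L[ℝ] KE N)) {0}ᶜ z :=
    fun z hz => (EuclideanGeometry.hasFDerivAt_inversion hz).hasFDerivWithinAt
  have hi : Set.InjOn (EuclideanGeometry.inversion (0 : KE N) R) {0}ᶜ :=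
    (EuclideanGeometry.inversion_injective _ hR).injOn
  have hr : (volume : Measure (KE N)).restrict {0}ᶜ = volume :=
    Measure.restrict_eq_self_of_ae_mem (by simp [ae_iff])
  have h1 := integrableOn_image_iff_integrableOn_abs_det_fderiv_smul volume hs hd hi G
  have h2 := integral_image_eq_integral_abs_det_fderiv_smul volume hs hd hi G
  simp only [kimg hR, IntegrableOn, hr, kdet, dist_zero_right, smul_eq_mul] at h1 h2
  exact ⟨h1, h2⟩

theorem kdom {N : ℕ} (hN : 2 ≤ N) {α : ℝ} (hα : α ∈ Set.Ioo (0 : ℝ) 1) :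
    Integrable (fun y : KE N => min (‖y‖ ^ 2) 1 * ‖y‖ ^ (-((N : ℝ) + 2 * α))) := by
  have : Nonempty (Fin N) := ⟨⟨0, by omega⟩⟩
  obtain ⟨h0, h1⟩ := hα
  rw [integrable_fun_norm_addHaar volume
    (f := fun r : ℝ => min (r ^ 2) 1 * r ^ (-((N : ℝ) + 2 * α)))]
  have key : ∀ y : ℝ, 0 < y → y ^ (N - 1) * y ^ (-((N : ℝ) + 2 * α)) = y ^ (-1 - 2 * α) := by
    intro y hy
    rw [← Real.rpow_natCast, ← Real.rpow_add hy, Nat.cast_sub (by omega)]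
    congr 1; push_cast; ring
  rw [← Set.Ioc_union_Ioi_eq_Ioi (zero_le_one' ℝ)]
  refine IntegrableOn.union ?_ ?_
  · have : IntegrableOn (fun y : ℝ => y ^ (1 - 2 * α)) (Set.Ioc 0 1) := by
      rw [← intervalIntegrable_iff_integrableOn_Ioc_of_le zero_le_one]
      exact intervalIntegral.intervalIntegrable_rpow' (by linarith)
    refine this.congr_fun ?_ measurableSet_Ioc
    intro y hy
    have hy2 : y ^ 2 ≤ 1 := by nlinarith [hy.1, hy.2]
    simp only [smul_eq_mul, finrank_euclideanSpace, Fintype.card_fin, min_eq_left hy2]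
    rw [mul_left_comm, key y hy.1, ← Real.rpow_natCast, ← Real.rpow_add hy.1]
    congr 1; push_cast; ring
  · have : IntegrableOn (fun y : ℝ => y ^ (-1 - 2 * α)) (Set.Ioi 1) :=
      integrableOn_Ioi_rpow_of_lt (by linarith) one_pos
    refine this.congr_fun ?_ measurableSet_Ioi
    intro y hy
    have hy1 : (1 : ℝ) < y := hy
    have hy2 : 1 ≤ y ^ 2 := by nlinarith
    simp only [smul_eq_mul, finrank_euclideanSpace, Fintype.card_fin, min_eq_right hy2, one_mul]
    rw [key y (by linarith)]

/-- Regularity consequences of being C² with compact support. -/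
theorem kreg {N : ℕ} {f : KE N → ℝ} (hf : ContDiff ℝ 2 f) (hs : HasCompactSupport f) :
    ∃ C : ℝ, 0 ≤ C ∧ (∀ x y, |f (x + y) - f x| ≤ C * ‖y‖) ∧ (∀ x y, |f (x + y) - f x| ≤ C) ∧
      (∀ x y, |nlD f x y| ≤ C * min (‖y‖ ^ 2) 1) := by
  obtain ⟨L, hL⟩ := hf.lipschitzWith_of_hasCompactSupport hs (by norm_num)
  obtain ⟨M, hM⟩ := hs.exists_bound_of_continuous hf.continuous
  have hf' : ContDiff ℝ 1 (fderiv ℝ f) := hf.fderiv_right (by norm_num)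
  obtain ⟨L', hL'⟩ := hf'.lipschitzWith_of_hasCompactSupport (hs.fderiv ℝ) (by norm_num)
  have hM0 : 0 ≤ M := (norm_nonneg _).trans (hM 0)
  have hL2 : ∀ x y, |f (x + y) - f x| ≤ L * ‖y‖ := by
    intro x y
    have := hL.dist_le_mul (x + y) x
    simpa [Real.dist_eq, dist_eq_norm] using this
  have hM2 : ∀ x y, |f (x + y) - f x| ≤ 2 * M := by
    intro x y
    have h1 := hM (x + y)
    have h2 := hM x
    rw [Real.norm_eq_abs] at h1 h2
    have := abs_sub (f (x + y)) (f x)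
    linarith
  have hD : ∀ x y, |nlD f x y| ≤ 2 * L' * ‖y‖ ^ 2 := by
    intro x y
    have hdf : Differentiable ℝ f := hf.differentiable (by norm_num)
    have hd : ∀ z ∈ Metric.closedBall (0 : KE N) ‖y‖,
        HasFDerivWithinAt (fun z => f (x + z) + f (x - z))
          (fderiv ℝ f (x + z) - fderiv ℝ f (x - z)) (Metric.closedBall (0 : KE N) ‖y‖) z := by
      intro z _
      have h1 : HasFDerivAt (fun z => f (x + z)) (fderiv ℝ f (x + z)) z := by
        have h := (hdf (x + z)).hasFDerivAt.comp z ((hasFDerivAt_id z).const_add x)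
        rw [ContinuousLinearMap.comp_id] at h
        exact h
      have h2 : HasFDerivAt (fun z => f (x - z)) (-fderiv ℝ f (x - z)) z := by
        have h := (hdf (x - z)).hasFDerivAt.comp z ((hasFDerivAt_id z).const_sub x)
        rw [ContinuousLinearMap.comp_neg, ContinuousLinearMap.comp_id] at h
        exact h
      rw [sub_eq_add_neg]
      exact (h1.add h2).hasFDerivWithinAt
    have hb : ∀ z ∈ Metric.closedBall (0 : KE N) ‖y‖,
        ‖fderiv ℝ f (x + z) - fderiv ℝ f (x - z)‖ ≤ 2 * L' * ‖y‖ := by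
      intro z hz
      have := hL'.dist_le_mul (x + z) (x - z)
      rw [dist_eq_norm, dist_eq_norm] at this
      have h2 : x + z - (x - z) = (2 : ℝ) • z := by rw [two_smul]; abel
      rw [h2, norm_smul, Real.norm_two] at this
      have hz' : ‖z‖ ≤ ‖y‖ := by simpa using hz
      have := L'.2
      calc _ ≤ _ := by assumption
        _ = 2 * L' * ‖z‖ := by ring
        _ ≤ _ := by gcongr
    have := (convex_closedBall (0 : KE N) ‖y‖).norm_image_sub_le_of_norm_hasFDerivWithin_le hd hb
      (x := 0) (y := y) (by simp) (by simp)
    simp only [add_zero, sub_zero, Real.norm_eq_abs] at this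
    rw [nlD, two_mul (f x)]
    calc _ ≤ _ := this
      _ = _ := by ring
  refine ⟨max (L : ℝ) (max (4 * M) (2 * L')), le_max_of_le_left L.2, fun x y => ?_, fun x y => ?_, fun x y => ?_⟩
  · exact (hL2 x y).trans (by gcongr; exact le_max_left _ _)
  · exact (hM2 x y).trans (le_max_of_le_right (le_max_of_le_left (by linarith)))
  · have hC0 : (0:ℝ) ≤ max (L : ℝ) (max (4 * M) (2 * L')) := le_max_of_le_left L.2
    rw [mul_min_of_nonneg _ _ hC0, le_min_iff]
    constructor
    · exact (hD x y).trans (by gcongr; exact le_max_of_le_right (le_max_right _ _))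
    · rw [mul_one]
      refine le_trans ?_ (le_max_of_le_right (le_max_left _ _))
      have h1 := hM2 x y
      have h2 := hM2 x (-y)
      rw [← sub_eq_add_neg] at h2
      have : nlD f x y = (f (x + y) - f x) + (f (x - y) - f x) := by rw [nlD]; ring
      rw [this]
      exact (abs_add_le _ _).trans (by linarith)

theorem kw_nonneg {N : ℕ} {ε : ℝ} (hε : 0 < ε) (x z : KE N) : 0 ≤ kw ε x z := by
  unfold kw; positivity

theorem kw_le_one {N : ℕ} {ε : ℝ} (hε : 0 < ε) (x z : KE N) : kw ε x z ≤ 1 := by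
  unfold kw
  refine div_le_one_of_le₀ ?_ (by positivity)
  have : 0 ≤ ε * (‖z‖ * ‖x‖) := by positivity
  linarith

theorem kw_lin_real {ε a r p : ℝ} (hε : 0 < ε) (ha : 0 < a) (hr : 0 ≤ r) (hp0 : 0 ≤ p)
    (hp : a - r ≤ p) : r ^ 2 / (r ^ 2 + ε * (p * a)) ≤ (1 / (ε * a) + 2 / a) * r := by
  rcases hr.eq_or_lt with h | hr0
  · simp [← h]
  rw [div_le_iff₀ (by positivity)]
  rcases le_or_gt r (a / 2) with h | h
  · have h1 : a / 2 ≤ p := by linarith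
    have h2 : 1 / (ε * a) * r * (ε * (p * a)) = r * p := by field_simp
    have h3 : r * r ≤ r * p := by gcongr; linarith
    have h4 : 0 ≤ (1 / (ε * a) + 2 / a) * r * r ^ 2 := by positivity
    have h5 : 0 ≤ 2 / a * r * (ε * (p * a)) := by positivity
    nlinarith
  · have h1 : 1 ≤ 2 / a * r := by
      rw [div_mul_eq_mul_div, le_div_iff₀ ha]; linarith
    have h2 : 1 ≤ (1 / (ε * a) + 2 / a) * r := by
      have : 0 ≤ 1 / (ε * a) * r := by positivity
      linarith
    have h3 : 0 ≤ ε * (p * a) := by positivity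
    nlinarith [sq_nonneg r]

theorem kw_diff_real {ε a r p q : ℝ} (hε : 0 < ε) (ha : 0 < a) (hr : 0 ≤ r) (hp0 : 0 ≤ p)
    (hp : a - r ≤ p) (hq0 : 0 ≤ q) (hq : a - r ≤ q) (hpq : q - p ≤ 2 * r) :
    r ^ 2 / (r ^ 2 + ε * (p * a)) - r ^ 2 / (r ^ 2 + ε * (q * a)) ≤ 4 / a * r := by
  rcases hr.eq_or_lt with h | hr0
  · simp [← h]
  rcases le_or_gt r (a / 2) with h | h
  · have hp1 : a / 2 ≤ p := by linarith
    have hq1 : a / 2 ≤ q := by linarith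
    set s := ε * (a / 2 * a) with hs
    have hs0 : 0 < s := by positivity
    have h1 : s ≤ ε * (p * a) := by rw [hs]; gcongr
    have h2 : s ≤ ε * (q * a) := by rw [hs]; gcongr
    rw [div_sub_div _ _ (by positivity) (by positivity), div_le_iff₀ (by positivity)]
    have e1 : r ^ 2 * (r ^ 2 + ε * (q * a)) - (r ^ 2 + ε * (p * a)) * r ^ 2
        = r ^ 2 * (ε * a) * (q - p) := by ring
    rw [e1]
    have e2 : r ^ 2 * (ε * a) * (2 * r) = 4 / a * r * (r ^ 2 * s) := by
      rw [hs]; field_simp; ring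
    calc r ^ 2 * (ε * a) * (q - p) ≤ r ^ 2 * (ε * a) * (2 * r) := by gcongr
      _ = 4 / a * r * (r ^ 2 * s) := e2
      _ ≤ 4 / a * r * ((r ^ 2 + ε * (p * a)) * (r ^ 2 + ε * (q * a))) := by
        have : r ^ 2 * s ≤ (r ^ 2 + ε * (p * a)) * (r ^ 2 + ε * (q * a)) := by
          apply mul_le_mul _ _ hs0.le (by positivity)
          · have : 0 ≤ ε * (p * a) := by positivity
            linarith
          · nlinarith [sq_nonneg r]
        gcongr
  · have h1 : 1 ≤ 4 / a * r := by
      rw [div_mul_eq_mul_div, le_div_iff₀ ha]; linarith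
    have h2 : r ^ 2 / (r ^ 2 + ε * (p * a)) ≤ 1 := by
      refine div_le_one_of_le₀ ?_ (by positivity)
      have : 0 ≤ ε * (p * a) := by positivity
      linarith
    have h3 : 0 ≤ r ^ 2 / (r ^ 2 + ε * (q * a)) := by positivity
    linarith

theorem kw_add {N : ℕ} (ε : ℝ) (x y : KE N) :
    kw ε x (x + y) = ‖y‖ ^ 2 / (‖y‖ ^ 2 + ε * (‖x + y‖ * ‖x‖)) := by
  simp [kw]

theorem kw_sub {N : ℕ} (ε : ℝ) (x y : KE N) :
    kw ε x (x - y) = ‖y‖ ^ 2 / (‖y‖ ^ 2 + ε * (‖x - y‖ * ‖x‖)) := by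
  simp [kw]

theorem kw_lin {N : ℕ} {ε : ℝ} (hε : 0 < ε) {x : KE N} (hx : x ≠ 0) (y : KE N) :
    kw ε x (x + y) ≤ (1 / (ε * ‖x‖) + 2 / ‖x‖) * ‖y‖ := by
  rw [kw_add]
  refine kw_lin_real hε (norm_pos_iff.2 hx) (norm_nonneg _) (norm_nonneg _) ?_
  have := norm_sub_le (x + y) y
  simp only [add_sub_cancel_right] at this
  linarith

theorem kw_diff {N : ℕ} {ε : ℝ} (hε : 0 < ε) {x : KE N} (hx : x ≠ 0) (y : KE N) :
    |kw ε x (x - y) - kw ε x (x + y)| ≤ 4 / ‖x‖ * ‖y‖ := by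
  have ha := norm_pos_iff.2 hx
  have h1 : ‖x‖ - ‖y‖ ≤ ‖x + y‖ := by
    have := norm_sub_le (x + y) y
    simp only [add_sub_cancel_right] at this
    linarith
  have h2 : ‖x‖ - ‖y‖ ≤ ‖x - y‖ := norm_sub_norm_le x y
  have h3 := norm_add_le x y
  have h4 := norm_sub_le x y
  have h5 : ‖x + y‖ - ‖x - y‖ ≤ 2 * ‖y‖ := by
    have := norm_sub_norm_le (x + y) (x - y)
    have e : x + y - (x - y) = (2 : ℝ) • y := by rw [two_smul]; abel
    rwa [e, norm_smul, Real.norm_two] at this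
  have h6 : ‖x - y‖ - ‖x + y‖ ≤ 2 * ‖y‖ := by
    have := norm_sub_norm_le (x - y) (x + y)
    have e : x - y - (x + y) = (-2 : ℝ) • y := by rw [neg_smul, two_smul]; abel
    rw [e, norm_smul] at this
    simpa using this
  rw [kw_add, kw_sub, abs_sub_le_iff]
  exact ⟨kw_diff_real hε ha (norm_nonneg _) (norm_nonneg _) h2 (norm_nonneg _) h1 h5,
    kw_diff_real hε ha (norm_nonneg _) (norm_nonneg _) h1 (norm_nonneg _) h2 h6⟩

theorem kw_tendsto {N : ℕ} {x z : KE N} (hz : z ≠ x) :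
    Filter.Tendsto (fun ε => kw ε x z) (nhdsWithin 0 (Set.Ioi 0)) (nhds 1) := by
  have h0 : ‖z - x‖ ^ 2 ≠ 0 := by
    have := norm_pos_iff.2 (sub_ne_zero.2 hz)
    positivity
  have : ContinuousAt (fun ε => kw ε x z) 0 := by
    unfold kw
    refine ContinuousAt.div (by fun_prop) (by fun_prop) (by simpa using h0)
  have h1 : kw 0 x z = 1 := by simp only [kw, zero_mul, add_zero]; exact div_self h0
  have h2 := this.tendsto
  rw [h1] at h2
  exact h2.mono_left nhdsWithin_le_nhds

theorem kw_meas {N : ℕ} (ε : ℝ) (x : KE N) : Measurable (kw ε x) := by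
  unfold kw; fun_prop

theorem kdiff_bound {N : ℕ} {C D f w : ℝ} {y : KE N} (hC : 0 ≤ C) (h1 : |f| ≤ C * ‖y‖)
    (h2 : |f| ≤ C) (h3 : |w| ≤ D * ‖y‖) (h4 : |w| ≤ 1) :
    |f * w| ≤ (C * D + C) * min (‖y‖ ^ 2) 1 := by
  rw [abs_mul]
  rcases le_total (‖y‖ ^ 2) 1 with h | h
  · rw [min_eq_left h]
    calc |f| * |w| ≤ (C * ‖y‖) * (D * ‖y‖) := by gcongr
      _ = C * D * ‖y‖ ^ 2 := by ring
      _ ≤ _ := by nlinarith [mul_nonneg hC (sq_nonneg ‖y‖)]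
  · rw [min_eq_right h, mul_one]
    have hD : 0 ≤ C * D := by
      refine mul_nonneg hC ?_
      by_contra hD
      have := abs_nonneg w
      have hy : 0 < ‖y‖ := by
        rcases (norm_nonneg y).eq_or_lt with h' | h'
        · rw [← h'] at h; norm_num at h
        · exact h'
      nlinarith
    calc |f| * |w| ≤ C * 1 := by gcongr
      _ ≤ _ := by linarith

theorem kF_int {N : ℕ} (hN : 2 ≤ N) {α : ℝ} (hα : α ∈ Set.Ioo (0 : ℝ) 1) {f : KE N → ℝ}
    (hf : ContDiff ℝ 2 f) (hs : HasCompactSupport f) {x : KE N} (hx : x ≠ 0) {ε : ℝ} (hε : 0 < ε) :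
    Integrable (kF ((N : ℝ) + 2 * α) ε f x) := by
  obtain ⟨C, hC, h1, h2, h3⟩ := kreg hf hs
  have hfm : Measurable f := hf.continuous.measurable
  have hwm := kw_meas ε x
  have hm : Measurable (kF ((N : ℝ) + 2 * α) ε f x) := by
    unfold kF; fun_prop
  suffices h : Integrable (fun y => kF ((N : ℝ) + 2 * α) ε f x (x + y)) by
    have := h.comp_sub_right x
    simpa using this
  refine ((kdom hN hα).const_mul (C * (1 / (ε * ‖x‖) + 2 / ‖x‖) + C)).mono'
    (hm.comp (measurable_const_add x)).aestronglyMeasurable (Filter.Eventually.of_forall fun y => ?_)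
  rw [Real.norm_eq_abs, kF, abs_mul, add_sub_cancel_left, ← mul_assoc,
    abs_of_nonneg (Real.rpow_nonneg (norm_nonneg y) _)]
  refine mul_le_mul_of_nonneg_right ?_ (Real.rpow_nonneg (norm_nonneg y) _)
  refine kdiff_bound hC (h1 x y) (h2 x y) ?_ ?_
  · rw [abs_of_nonneg (kw_nonneg hε _ _)]; exact kw_lin hε hx y
  · rw [abs_of_nonneg (kw_nonneg hε _ _)]; exact kw_le_one hε _ _

theorem knlD_int {N : ℕ} (hN : 2 ≤ N) {α : ℝ} (hα : α ∈ Set.Ioo (0 : ℝ) 1) {f : KE N → ℝ}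
    (hf : ContDiff ℝ 2 f) (hs : HasCompactSupport f) (x : KE N) :
    Integrable (fun y => nlD f x y * ‖y‖ ^ (-((N : ℝ) + 2 * α))) := by
  obtain ⟨C, hC, h1, h2, h3⟩ := kreg hf hs
  have hfm : Measurable f := hf.continuous.measurable
  have hm : Measurable (fun y => nlD f x y * ‖y‖ ^ (-((N : ℝ) + 2 * α))) := by
    unfold nlD; fun_prop
  refine ((kdom hN hα).const_mul C).mono'
    hm.aestronglyMeasurable (Filter.Eventually.of_forall fun y => ?_)
  rw [Real.norm_eq_abs, abs_mul, ← mul_assoc, abs_of_nonneg (Real.rpow_nonneg (norm_nonneg y) _)]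
  exact mul_le_mul_of_nonneg_right (h3 x y) (Real.rpow_nonneg (norm_nonneg y) _)

theorem kF_tendsto {N : ℕ} (hN : 2 ≤ N) {α : ℝ} (hα : α ∈ Set.Ioo (0 : ℝ) 1) {f : KE N → ℝ}
    (hf : ContDiff ℝ 2 f) (hs : HasCompactSupport f) {x : KE N} (hx : x ≠ 0) :
    Filter.Tendsto (fun ε => 2 * ∫ z, kF ((N : ℝ) + 2 * α) ε f x z) (nhdsWithin 0 (Set.Ioi 0))
      (nhds (∫ y, nlD f x y * ‖y‖ ^ (-((N : ℝ) + 2 * α)))) := by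
  have : Nonempty (Fin N) := ⟨⟨0, by omega⟩⟩
  obtain ⟨C, hC, h1, h2, h3⟩ := kreg hf hs
  have hfm : Measurable f := hf.continuous.measurable
  set e := (N : ℝ) + 2 * α with he
  have hev : ∀ᶠ ε : ℝ in nhdsWithin 0 (Set.Ioi 0), 0 < ε := self_mem_nhdsWithin
  have key : ∀ᶠ ε : ℝ in nhdsWithin 0 (Set.Ioi 0),
      ∫ y, (nlD f x y * kw ε x (x + y)
        + (f (x - y) - f x) * (kw ε x (x - y) - kw ε x (x + y))) * ‖y‖ ^ (-e)
      = 2 * ∫ z, kF e ε f x z := by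
    filter_upwards [hev] with ε hε
    have hi := kF_int hN hα hf hs hx hε
    have i1 : Integrable (fun y => kF e ε f x (x + y)) := hi.comp_add_left x
    have i2 : Integrable (fun y => kF e ε f x (x - y)) := hi.comp_sub_left x
    have e1 : ∫ y, kF e ε f x (x + y) = ∫ z, kF e ε f x z := integral_add_left_eq_self _ x
    have e2 : ∫ y, kF e ε f x (x - y) = ∫ z, kF e ε f x z := integral_sub_left_eq_self _ _ x
    rw [two_mul]
    nth_rewrite 1 [← e1]
    rw [← e2, ← integral_add i1 i2]
    congr 1
    ext y
    simp only [kF, nlD, add_sub_cancel_left, sub_sub_cancel_left, norm_neg]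
    ring
  refine Filter.Tendsto.congr' key ?_
  refine tendsto_integral_filter_of_dominated_convergence
    (fun y => (C + (C * (4 / ‖x‖) + C)) * (min (‖y‖ ^ 2) 1 * ‖y‖ ^ (-e))) ?_ ?_
    ((kdom hN hα).const_mul _) ?_
  · refine Filter.Eventually.of_forall fun ε => Measurable.aestronglyMeasurable ?_
    have hwm := kw_meas ε x
    unfold nlD
    fun_prop
  · filter_upwards [hev] with ε hε
    refine Filter.Eventually.of_forall fun y => ?_
    rw [Real.norm_eq_abs, abs_mul, ← mul_assoc, abs_of_nonneg (Real.rpow_nonneg (norm_nonneg y) _)]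
    refine mul_le_mul_of_nonneg_right ?_ (Real.rpow_nonneg (norm_nonneg y) _)
    refine (abs_add_le _ _).trans ?_
    rw [add_mul]
    have a1 := kw_nonneg hε x (x + y)
    have a2 := kw_le_one hε x (x + y)
    have a3 := kw_nonneg hε x (x - y)
    have a4 := kw_le_one hε x (x - y)
    refine add_le_add ?_ (kdiff_bound hC ?_ ?_ (kw_diff hε hx y) ?_)
    · rw [abs_mul, abs_of_nonneg a1]
      calc |nlD f x y| * kw ε x (x + y) ≤ |nlD f x y| * 1 := by gcongr
        _ ≤ _ := by rw [mul_one]; exact h3 x y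
    · simpa [sub_eq_add_neg] using h1 x (-y)
    · simpa [sub_eq_add_neg] using h2 x (-y)
    · rw [abs_le]; constructor <;> linarith
  · have hne : ∀ᵐ y : KE N, y ≠ 0 := by simp [ae_iff]
    filter_upwards [hne] with y hy
    have t1 : Filter.Tendsto (fun ε => kw ε x (x + y)) (nhdsWithin 0 (Set.Ioi 0)) (nhds 1) :=
      kw_tendsto (by simpa using hy)
    have t2 : Filter.Tendsto (fun ε => kw ε x (x - y)) (nhdsWithin 0 (Set.Ioi 0)) (nhds 1) :=
      kw_tendsto (by simpa using hy)
    have := (((t1.const_mul (nlD f x y)).add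
      ((t2.sub t1).const_mul (f (x - y) - f x))).mul_const (‖y‖ ^ (-e)))
    simpa using this

theorem kinv_one {N : ℕ} (z : KE N) :
    EuclideanGeometry.inversion 0 1 z = (‖z‖ ^ 2)⁻¹ • z := by
  simp [EuclideanGeometry.inversion]

theorem kinv_norm {N : ℕ} (R : ℝ) (z : KE N) :
    ‖EuclideanGeometry.inversion 0 R z‖ = R ^ 2 / ‖z‖ := by
  have := EuclideanGeometry.dist_inversion_center (0 : KE N) z R
  simpa using this

theorem kinv_dist {N : ℕ} (R : ℝ) {z x : KE N} (hz : z ≠ 0) (hx : x ≠ 0) :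
    ‖EuclideanGeometry.inversion 0 R z - EuclideanGeometry.inversion 0 R x‖
      = R ^ 2 / (‖z‖ * ‖x‖) * ‖z - x‖ := by
  have := EuclideanGeometry.dist_inversion_inversion hz hx R
  simpa [dist_eq_norm] using this

theorem kw_inv {N : ℕ} {R : ℝ} (hR : R ≠ 0) (ε : ℝ) {z x : KE N} (hz : z ≠ 0) (hx : x ≠ 0) :
    kw ε (EuclideanGeometry.inversion 0 R x) (EuclideanGeometry.inversion 0 R z) = kw ε x z := by
  have hz' := norm_pos_iff.2 hz
  have hx' := norm_pos_iff.2 hx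
  rw [kw, kw, kinv_norm, kinv_norm, kinv_dist R hz hx]
  have h : (R ^ 2 / (‖z‖ * ‖x‖)) ^ 2 ≠ 0 := by positivity
  rw [← mul_div_mul_left (‖z - x‖ ^ 2) _ h]
  congr 1
  · ring
  · field_simp

theorem kelvin_support_zero {N : ℕ} {α : ℝ} {u : KE N → ℝ} (hs : HasCompactSupport u) :
    ∀ᶠ z in nhds (0 : KE N), kelvin α u z = 0 := by
  obtain ⟨r, hr⟩ := hs.isCompact.isBounded.subset_closedBall (0 : KE N)
  have hr' : 0 < max r 1 := by positivity
  filter_upwards [Metric.ball_mem_nhds (0 : KE N) (inv_pos.2 hr')] with z hz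
  rw [kelvin]
  split_ifs with h0
  · rfl
  · have hz0 := norm_pos_iff.2 h0
    have hz1 : ‖z‖ < (max r 1)⁻¹ := by simpa using hz
    have : u ((‖z‖ ^ 2)⁻¹ • z) = 0 := by
      by_contra hne
      have h2 := hr (subset_tsupport u hne)
      rw [← kinv_one, mem_closedBall_zero_iff, kinv_norm, one_pow] at h2
      have h3 : max r 1 < 1 / ‖z‖ := by
        rw [one_div]; exact (lt_inv_comm₀ hz0 hr').1 hz1
      have := le_max_left r 1
      linarith
    rw [this, mul_zero]

theorem kelvin_compact {N : ℕ} {α : ℝ} {u : KE N → ℝ} (h0 : (0 : KE N) ∉ tsupport u) :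
    HasCompactSupport (kelvin α u) := by
  obtain ⟨d, hd, hb⟩ := Metric.isOpen_iff.1 (isClosed_tsupport u).isOpen_compl 0 h0
  refine HasCompactSupport.intro (isCompact_closedBall (0 : KE N) d⁻¹) fun z hz => ?_
  rw [kelvin]
  split_ifs with hz0
  · rfl
  · have hz' := norm_pos_iff.2 hz0
    have hz1 : d⁻¹ < ‖z‖ := by simpa using hz
    have : u ((‖z‖ ^ 2)⁻¹ • z) = 0 := by
      refine image_eq_zero_of_notMem_tsupport (hb ?_)
      rw [← kinv_one, mem_ball_zero_iff, kinv_norm, one_pow, one_div]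
      exact (inv_lt_comm₀ hd hz').1 hz1
    rw [this, mul_zero]

theorem kelvin_contDiff {N : ℕ} {α : ℝ} {u : KE N → ℝ} (hu : ContDiff ℝ 2 u)
    (hs : HasCompactSupport u) : ContDiff ℝ 2 (kelvin α u) := by
  rw [contDiff_iff_contDiffAt]
  intro z
  by_cases hz : z = 0
  · subst hz
    exact contDiffAt_const.congr_of_eventuallyEq (kelvin_support_zero hs)
  · have hn : ‖z‖ ≠ 0 := norm_ne_zero_iff.2 hz
    have h1 : ContDiffAt ℝ 2 (fun y : KE N => ‖y‖) z := contDiffAt_norm ℝ hz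
    have h2 : ContDiffAt ℝ 2
        (fun y : KE N => ‖y‖ ^ (2 * α - (N : ℝ)) * u ((‖y‖ ^ 2)⁻¹ • y)) z := by
      refine (h1.rpow_const_of_ne hn).mul ?_
      exact hu.contDiffAt.comp z (((h1.pow 2).inv (by positivity)).smul contDiffAt_id)
    refine h2.congr_of_eventuallyEq ?_
    filter_upwards [isOpen_ne.mem_nhds hz] with y hy
    rw [kelvin, if_neg hy]

theorem kF_split {N : ℕ} (α ε : ℝ) (u : KE N → ℝ) {x z : KE N} (hx : x ≠ 0) (hz : z ≠ 0) :
    kF ((N : ℝ) + 2 * α) ε (kelvin α u) x z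
      = ‖x‖ ^ (-((N : ℝ) + 2 * α)) * (((1 / ‖z‖) ^ 2) ^ N *
          kF ((N : ℝ) + 2 * α) ε u (EuclideanGeometry.inversion 0 1 x)
            (EuclideanGeometry.inversion 0 1 z))
        + u (EuclideanGeometry.inversion 0 1 x) *
          kF ((N : ℝ) + 2 * α) ε (fun y => ‖y‖ ^ (2 * α - (N : ℝ))) x z := by
  have hz' := norm_pos_iff.2 hz
  have hx' := norm_pos_iff.2 hx
  have hpow : ‖x‖ ^ (-((N : ℝ) + 2 * α)) * (((1 / ‖z‖) ^ 2) ^ N *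
      (1 ^ 2 / (‖z‖ * ‖x‖) * ‖z - x‖) ^ (-((N : ℝ) + 2 * α)))
      = ‖z‖ ^ (2 * α - (N : ℝ)) * ‖z - x‖ ^ (-((N : ℝ) + 2 * α)) := by
    have e1 : ((1 / ‖z‖) ^ 2) ^ N = ‖z‖ ^ (-(2 * N : ℝ)) := by
      rw [← pow_mul, one_div, inv_pow, ← Real.rpow_natCast, Real.rpow_neg hz'.le]
      push_cast; rfl
    have e2 : (1 ^ 2 / (‖z‖ * ‖x‖) : ℝ) ^ (-((N : ℝ) + 2 * α))
        = ‖z‖ ^ ((N : ℝ) + 2 * α) * ‖x‖ ^ ((N : ℝ) + 2 * α) := by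
      rw [one_pow, one_div, Real.inv_rpow (by positivity), ← Real.rpow_neg (by positivity), neg_neg,
        Real.mul_rpow hz'.le hx'.le]
    have e3 : ‖z‖ ^ (2 * α - (N : ℝ)) = ‖z‖ ^ (-(2 * N : ℝ)) * ‖z‖ ^ ((N : ℝ) + 2 * α) := by
      rw [← Real.rpow_add hz']; congr 1; ring
    have e4 : ‖x‖ ^ (-((N : ℝ) + 2 * α)) * ‖x‖ ^ ((N : ℝ) + 2 * α) = 1 := by
      rw [← Real.rpow_add hx', neg_add_cancel, Real.rpow_zero]
    rw [Real.mul_rpow (by positivity) (norm_nonneg _), e1, e2, e3]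
    linear_combination (‖z‖ ^ (-(2 * N : ℝ)) * ‖z‖ ^ ((N : ℝ) + 2 * α)
      * ‖z - x‖ ^ (-((N : ℝ) + 2 * α))) * e4
  have hk : ∀ y : KE N, y ≠ 0 → kelvin α u y
      = ‖y‖ ^ (2 * α - (N : ℝ)) * u (EuclideanGeometry.inversion 0 1 y) := fun y hy => by
    rw [kelvin, if_neg hy, kinv_one]
  rw [kF, kF, kF, hk x hx, hk z hz, kw_inv one_ne_zero ε hz hx, kinv_dist 1 hz hx]
  linear_combination (-(u (EuclideanGeometry.inversion 0 1 z)
    - u (EuclideanGeometry.inversion 0 1 x)) * kw ε x z) * hpow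

theorem kF_anti {N : ℕ} (α ε : ℝ) {x z : KE N} (hx : x ≠ 0) (hz : z ≠ 0) :
    ((‖x‖ / ‖z‖) ^ 2) ^ N *
      kF ((N : ℝ) + 2 * α) ε (fun y => ‖y‖ ^ (2 * α - (N : ℝ))) x
        (EuclideanGeometry.inversion 0 ‖x‖ z)
      = - kF ((N : ℝ) + 2 * α) ε (fun y => ‖y‖ ^ (2 * α - (N : ℝ))) x z := by
  have hz' := norm_pos_iff.2 hz
  have hx' := norm_pos_iff.2 hx
  have hxx : EuclideanGeometry.inversion 0 ‖x‖ x = x := by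
    have := EuclideanGeometry.inversion_dist_center (0 : KE N) x
    simpa using this
  have h1 : ‖EuclideanGeometry.inversion 0 ‖x‖ z - x‖ = ‖x‖ / ‖z‖ * ‖z - x‖ := by
    have := kinv_dist ‖x‖ hz hx
    rw [hxx] at this
    rw [this]; field_simp
  have h2 : kw ε x (EuclideanGeometry.inversion 0 ‖x‖ z) = kw ε x z := by
    have := kw_inv hx'.ne' ε hz hx
    rwa [hxx] at this
  have hq : 0 < ‖x‖ / ‖z‖ := by positivity
  rw [kF, kF, h1, h2, kinv_norm, Real.mul_rpow hq.le (norm_nonneg _)]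
  have e1 : ((‖x‖ / ‖z‖) ^ 2) ^ N * (‖x‖ / ‖z‖) ^ (-((N : ℝ) + 2 * α))
      = (‖x‖ / ‖z‖) ^ ((N : ℝ) - 2 * α) := by
    rw [← pow_mul, ← Real.rpow_natCast, ← Real.rpow_add hq]
    congr 1; push_cast; ring
  have e2 : (‖x‖ ^ 2 / ‖z‖) ^ (2 * α - (N : ℝ))
      = (‖x‖ / ‖z‖) ^ (2 * α - (N : ℝ)) * ‖x‖ ^ (2 * α - (N : ℝ)) := by
    rw [← Real.mul_rpow hq.le hx'.le]; congr 1; ring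
  have e3 : (‖x‖ / ‖z‖) ^ ((N : ℝ) - 2 * α) * (‖x‖ / ‖z‖) ^ (2 * α - (N : ℝ)) = 1 := by
    rw [← Real.rpow_add hq]; simp
  have e4 : (‖x‖ / ‖z‖) ^ ((N : ℝ) - 2 * α) * ‖x‖ ^ (2 * α - (N : ℝ)) = ‖z‖ ^ (2 * α - (N : ℝ)) := by
    have : ‖z‖ ^ (2 * α - (N : ℝ)) * (‖x‖ / ‖z‖) ^ (2 * α - (N : ℝ)) = ‖x‖ ^ (2 * α - (N : ℝ)) := by
      rw [← Real.mul_rpow hz'.le hq.le]; congr 1; field_simp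
    linear_combination (-(‖x‖ / ‖z‖) ^ ((N : ℝ) - 2 * α)) * this
      + ‖z‖ ^ (2 * α - (N : ℝ)) * e3
  rw [e2]
  set P := ‖z - x‖ ^ (-((N : ℝ) + 2 * α))
  set W := kw ε x z
  set A := (‖x‖ / ‖z‖) ^ (2 * α - (N : ℝ))
  set X := ‖x‖ ^ (2 * α - (N : ℝ))
  linear_combination ((A * X - X) * W * P) * e1 + (X * W * P) * e3 - (W * P) * e4

theorem kF_eq {N : ℕ} (hN : 2 ≤ N) {α : ℝ} (hα : α ∈ Set.Ioo (0 : ℝ) 1) {u : KE N → ℝ}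
    (hu : ContDiff ℝ 2 u) (hs : HasCompactSupport u) (h0 : (0 : KE N) ∉ tsupport u)
    {x : KE N} (hx : x ≠ 0) {ε : ℝ} (hε : 0 < ε) :
    ∫ z, kF ((N : ℝ) + 2 * α) ε (kelvin α u) x z
      = ‖x‖ ^ (-((N : ℝ) + 2 * α)) *
        ∫ z, kF ((N : ℝ) + 2 * α) ε u (EuclideanGeometry.inversion 0 1 x) z := by
  have : Nonempty (Fin N) := ⟨⟨0, by omega⟩⟩
  have hne : ∀ᵐ y : KE N, y ≠ 0 := by simp [ae_iff]
  have hx1 : EuclideanGeometry.inversion 0 1 x ≠ (0 : KE N) := fun h =>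
    hx ((EuclideanGeometry.inversion_eq_center one_ne_zero).1 h)
  have i1 := kF_int hN hα (kelvin_contDiff (α := α) hu hs) (kelvin_compact h0) hx hε
  have c := kcov hN (one_ne_zero (α := ℝ))
    (kF ((N : ℝ) + 2 * α) ε u (EuclideanGeometry.inversion 0 1 x))
  have i2 := (c.1.1 (kF_int hN hα hu hs hx1 hε)).const_mul (‖x‖ ^ (-((N : ℝ) + 2 * α)))
  have hg : ∫ z, kF ((N : ℝ) + 2 * α) ε (fun y => ‖y‖ ^ (2 * α - (N : ℝ))) x z = 0 := by
    have h1 := (kcov hN (norm_ne_zero_iff.2 hx)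
      (kF ((N : ℝ) + 2 * α) ε (fun y => ‖y‖ ^ (2 * α - (N : ℝ))) x)).2
    rw [integral_congr_ae (hne.mono fun z hz => kF_anti α ε hx hz), integral_neg] at h1
    linarith
  rw [c.2, ← integral_const_mul, ← sub_eq_zero, ← integral_sub i1 i2]
  rw [integral_congr_ae (g := fun z => u (EuclideanGeometry.inversion 0 1 x) *
          kF ((N : ℝ) + 2 * α) ε (fun y => ‖y‖ ^ (2 * α - (N : ℝ))) x z),
    integral_const_mul, hg, mul_zero]
  filter_upwards [hne] with z hz
  rw [kF_split α ε u hx hz]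
  ring

/-- Kelvin transform identity for the fractional Laplacian (footnote 1):
`(-Δ)^α ū (x) = |x|^{-(N+2α)} (-Δ)^α u (x/|x|²)`. -/
theorem kelvin_transform_identity
    (N : ℕ) (hN : 2 ≤ N) (α : ℝ) (hα : α ∈ Set.Ioo (0 : ℝ) 1)
    (u : EuclideanSpace ℝ (Fin N) → ℝ)
    (hu : ContDiff ℝ 2 u)
    (hu_supp : HasCompactSupport u)
    (hu_supp0 : (0 : EuclideanSpace ℝ (Fin N)) ∉ tsupport u) :
    ∀ x : EuclideanSpace ℝ (Fin N), x ≠ 0 →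
      Integrable (fun y => nlD (kelvin α u) x y * ‖y‖ ^ (-((N : ℝ) + 2 * α))) ∧
      Integrable (fun y => nlD u ((‖x‖ ^ 2)⁻¹ • x) y * ‖y‖ ^ (-((N : ℝ) + 2 * α))) ∧
      ∫ y, nlD (kelvin α u) x y * ‖y‖ ^ (-((N : ℝ) + 2 * α))
        = ‖x‖ ^ (-((N : ℝ) + 2 * α))
          * ∫ y, nlD u ((‖x‖ ^ 2)⁻¹ • x) y * ‖y‖ ^ (-((N : ℝ) + 2 * α)) := by
  intro x hx
  have hx1 : EuclideanGeometry.inversion 0 1 x ≠ (0 : KE N) := fun h =>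
    hx ((EuclideanGeometry.inversion_eq_center one_ne_zero).1 h)
  have hk := kelvin_contDiff (α := α) hu hu_supp
  have hks := kelvin_compact (α := α) hu_supp0
  refine ⟨knlD_int hN hα hk hks x, knlD_int hN hα hu hu_supp _, ?_⟩
  rw [← kinv_one]
  have t1 := kF_tendsto hN hα hk hks hx
  have t2 := (kF_tendsto hN hα hu hu_supp hx1).const_mul (‖x‖ ^ (-((N : ℝ) + 2 * α)))
  refine tendsto_nhds_unique t1 (t2.congr' ?_)
  have hev : ∀ᶠ ε : ℝ in nhdsWithin 0 (Set.Ioi 0), 0 < ε := self_mem_nhdsWithin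
  filter_upwards [hev] with ε hε
  rw [kF_eq hN hα hu hu_supp hu_supp0 hx hε]
  ring
end

section
/- Quantitative infimum estimate for supersolutions of the Lane–Emden inequality in cones (Lemma 4.3, classical form). Let N ≥ 2, α ∈ (0,1), 0 < λ ≤ Λ. Let ω, ω₁, ω₂ be nonempty open subsets of S^{N−1} with closure(ω₂) ⊆ ω₁, closure(ω₁) ⊆ ω, ω ≠ S^{N−1}, and let 0 < s₁ < s₂ < t₂ < t₁ < ∞. Then there exists a constant C > 0, depending only on N, α, λ, Λ, the sets ω_i and the numbers s_i, t_i, such that for every p ∈ ℝ, every R > 0, and every continuous u : ℝ^N → ℝ with u ≥ 0 on ℝ^N and u > 0 on C_ω which satisfies, for each x ∈ C_ω, that y ↦ S₋(δ(u,x,y)) |y|^{−(N+2α)} is Lebesgue integrable with ∫_{ℝ^N} S₋(δ(u,x,y)) |y|^{−(N+2α)} dy ≤ −u(x)^p, one has inf{ u(x)^p : x ∈ C_{ω₁}, s₁R < |x| < t₁R } ≤ C R^{−2α} · inf{ u(x) : x ∈ C_{ω₂}, s₂R < |x| < t₂R }. -/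
open MeasureTheory

/-- `S₋(t) = λ t⁺ - Λ t⁻`. -/
noncomputable def Sminus (l L t : ℝ) : ℝ := l * max t 0 - L * max (-t) 0

/-- The cone over a subset `ω` of the unit sphere. -/
def coneOf {N : ℕ} (ω : Set (EuclideanSpace ℝ (Fin N))) : Set (EuclideanSpace ℝ (Fin N)) :=
  {x | x ≠ 0 ∧ ‖x‖⁻¹ • x ∈ ω}

/-- The truncated kernel `min(|y|²,1) |y|^{-(N+2α)}` is integrable. -/
theorem kernel_integrable (N : ℕ) (hN : 2 ≤ N) (α : ℝ) (hα : α ∈ Set.Ioo (0 : ℝ) 1) :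
    Integrable (fun y : EuclideanSpace ℝ (Fin N) =>
      min (‖y‖ ^ 2) 1 * ‖y‖ ^ (-((N : ℝ) + 2 * α))) := by
  have : Nonempty (Fin N) := ⟨⟨0, by omega⟩⟩
  obtain ⟨h0, h1⟩ := hα
  have key := integrable_fun_norm_addHaar (E := EuclideanSpace ℝ (Fin N)) volume
    (f := fun r : ℝ => min (r ^ 2) 1 * r ^ (-((N : ℝ) + 2 * α)))
  rw [← Set.Ioc_union_Ioi_eq_Ioi (zero_le_one' ℝ), integrableOn_union] at key
  refine key.2 ⟨?_, ?_⟩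
  · have : IntegrableOn (fun r : ℝ => r ^ (1 - 2 * α)) (Set.Ioc 0 1) := by
      rw [← intervalIntegrable_iff_integrableOn_Ioc_of_le zero_le_one]
      exact intervalIntegral.intervalIntegrable_rpow' (by linarith)
    refine this.congr_fun ?_ measurableSet_Ioc
    intro r hr
    have hr0 : 0 < r := hr.1
    have hm : min (r ^ 2) 1 = r ^ 2 := min_eq_left (by nlinarith [hr.2])
    simp only [hm, smul_eq_mul, finrank_euclideanSpace, Fintype.card_fin]
    rw [← Real.rpow_natCast, ← Real.rpow_natCast, ← Real.rpow_add hr0, ← Real.rpow_add hr0]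
    congr 1
    rw [Nat.cast_sub (by omega)]
    push_cast
    ring
  · have : IntegrableOn (fun r : ℝ => r ^ (-1 - 2 * α)) (Set.Ioi 1) :=
      integrableOn_Ioi_rpow_of_lt (by linarith) one_pos
    refine this.congr_fun ?_ measurableSet_Ioi
    intro r hr
    have hr1 : 1 < r := hr
    have hr0 : 0 < r := by linarith
    have hm : min (r ^ 2) 1 = 1 := min_eq_right (by nlinarith)
    simp only [hm, smul_eq_mul, finrank_euclideanSpace, Fintype.card_fin]
    rw [← Real.rpow_natCast, one_mul, ← Real.rpow_add hr0]
    congr 1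
    rw [Nat.cast_sub (by omega)]
    push_cast
    ring

theorem kernel_scale_pt (N : ℕ) (α r : ℝ) (hr : 0 < r) (y : EuclideanSpace ℝ (Fin N)) :
    min (‖y‖ ^ 2 / r ^ 2) 1 * ‖y‖ ^ (-((N : ℝ) + 2 * α)) =
      r ^ (-((N : ℝ) + 2 * α)) *
        (min (‖r⁻¹ • y‖ ^ 2) 1 * ‖r⁻¹ • y‖ ^ (-((N : ℝ) + 2 * α))) := by
  have h : ‖r⁻¹ • y‖ = r⁻¹ * ‖y‖ := by
    rw [norm_smul, Real.norm_of_nonneg (by positivity)]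
  rw [h, Real.mul_rpow (by positivity) (norm_nonneg _), Real.inv_rpow hr.le]
  have : r ^ (-((N : ℝ) + 2 * α)) ≠ 0 := (Real.rpow_pos_of_pos hr _).ne'
  have e : (r⁻¹ * ‖y‖) ^ 2 = ‖y‖ ^ 2 / r ^ 2 := by field_simp
  rw [e]
  field_simp

theorem kernel_scale (N : ℕ) (hN : 2 ≤ N) (α : ℝ) (hα : α ∈ Set.Ioo (0 : ℝ) 1)
    (r : ℝ) (hr : 0 < r) :
    Integrable (fun y : EuclideanSpace ℝ (Fin N) =>
      min (‖y‖ ^ 2 / r ^ 2) 1 * ‖y‖ ^ (-((N : ℝ) + 2 * α))) ∧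
    ∫ y : EuclideanSpace ℝ (Fin N), min (‖y‖ ^ 2 / r ^ 2) 1 * ‖y‖ ^ (-((N : ℝ) + 2 * α)) =
      r ^ (-(2 * α)) * ∫ y : EuclideanSpace ℝ (Fin N),
        min (‖y‖ ^ 2) 1 * ‖y‖ ^ (-((N : ℝ) + 2 * α)) := by
  simp_rw [kernel_scale_pt N α r hr]
  constructor
  · exact ((kernel_integrable N hN α hα).comp_smul (inv_ne_zero hr.ne')).const_mul _
  · rw [integral_const_mul, Measure.integral_comp_inv_smul volume
      (fun y : EuclideanSpace ℝ (Fin N) => min (‖y‖ ^ 2) 1 * ‖y‖ ^ (-((N : ℝ) + 2 * α)))]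
    rw [finrank_euclideanSpace, Fintype.card_fin, abs_of_pos (by positivity), smul_eq_mul,
      ← mul_assoc, ← Real.rpow_natCast, ← Real.rpow_add hr]
    congr 2
    ring

theorem Sminus_lower (l L t c : ℝ) (hl : 0 < l) (hlL : l ≤ L) (hc : 0 ≤ c) (h : -c ≤ t) :
    -(L * c) ≤ Sminus l L t := by
  unfold Sminus
  have h1 : 0 ≤ l * max t 0 := mul_nonneg hl.le (le_max_right _ _)
  have h2 : L * max (-t) 0 ≤ L * c :=
    mul_le_mul_of_nonneg_left (max_le (by linarith) hc) (by linarith)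
  linarith

theorem annulus_ball {N : ℕ} (ω₁ ω₂ : Set (EuclideanSpace ℝ (Fin N)))
    (hω₁_open : IsOpen (Subtype.val ⁻¹' ω₁ :
      Set (Metric.sphere (0 : EuclideanSpace ℝ (Fin N)) 1)))
    (h21 : closure ω₂ ⊆ ω₁)
    (s₁ s₂ t₂ t₁ : ℝ) (hs₁ : 0 < s₁) (hs₁₂ : s₁ < s₂) (ht₂₁ : t₂ < t₁) :
    ∃ ρ : ℝ, 0 < ρ ∧ ∀ R : ℝ, 0 < R → ∀ x, x ∈ coneOf ω₂ → s₂ * R < ‖x‖ → ‖x‖ < t₂ * R →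
      ∀ z ∈ Metric.closedBall x (ρ * R),
        z ∈ coneOf ω₁ ∧ s₁ * R < ‖z‖ ∧ ‖z‖ < t₁ * R := by
  obtain ⟨U, hU, hUω⟩ := isOpen_induced_iff.1 hω₁_open
  have hcont : ContinuousOn (fun x : EuclideanSpace ℝ (Fin N) => ‖x‖⁻¹ • x) {x | x ≠ 0} := by
    refine ContinuousOn.smul (ContinuousOn.inv₀ continuous_norm.continuousOn ?_) continuousOn_id
    intro x hx
    exact norm_ne_zero_iff.2 hx
  have hmem : ∀ x : EuclideanSpace ℝ (Fin N), x ≠ 0 → (‖x‖⁻¹ • x ∈ U ↔ ‖x‖⁻¹ • x ∈ ω₁) := by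
    intro x hx
    have hs : ‖x‖⁻¹ • x ∈ Metric.sphere (0 : EuclideanSpace ℝ (Fin N)) 1 := by
      rw [mem_sphere_zero_iff_norm, norm_smul, norm_inv, norm_norm,
        inv_mul_cancel₀ (norm_ne_zero_iff.2 hx)]
    exact Set.ext_iff.1 hUω ⟨_, hs⟩
  have hopen : IsOpen {x : EuclideanSpace ℝ (Fin N) | x ∈ coneOf ω₁ ∧ s₁ < ‖x‖ ∧ ‖x‖ < t₁} := by
    have h1 : IsOpen ({x : EuclideanSpace ℝ (Fin N) | x ≠ 0} ∩
        (fun x : EuclideanSpace ℝ (Fin N) => ‖x‖⁻¹ • x) ⁻¹' U) :=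
      hcont.isOpen_inter_preimage isOpen_ne hU
    have h2 := (h1.inter (isOpen_lt continuous_const continuous_norm :
      IsOpen {x : EuclideanSpace ℝ (Fin N) | s₁ < ‖x‖})).inter
      (isOpen_lt continuous_norm continuous_const :
      IsOpen {x : EuclideanSpace ℝ (Fin N) | ‖x‖ < t₁})
    convert h2 using 1
    ext x
    simp only [coneOf, Set.mem_setOf_eq, Set.mem_inter_iff, Set.mem_preimage]
    constructor
    · rintro ⟨⟨a, b⟩, c, d⟩
      exact ⟨⟨⟨a, (hmem x a).2 b⟩, c⟩, d⟩
    · rintro ⟨⟨⟨a, b⟩, c⟩, d⟩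
      exact ⟨⟨a, (hmem x a).1 b⟩, c, d⟩
  have hs₂ : 0 < s₂ := hs₁.trans hs₁₂
  have hK : IsCompact {x : EuclideanSpace ℝ (Fin N) |
      (s₂ ≤ ‖x‖ ∧ ‖x‖ ≤ t₂) ∧ ‖x‖⁻¹ • x ∈ closure ω₂} := by
    have hA : IsClosed {x : EuclideanSpace ℝ (Fin N) | s₂ ≤ ‖x‖ ∧ ‖x‖ ≤ t₂} :=
      (isClosed_le continuous_const continuous_norm).inter
        (isClosed_le continuous_norm continuous_const)
    have hcl : IsClosed ({x : EuclideanSpace ℝ (Fin N) | s₂ ≤ ‖x‖ ∧ ‖x‖ ≤ t₂} ∩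
        (fun x : EuclideanSpace ℝ (Fin N) => ‖x‖⁻¹ • x) ⁻¹' closure ω₂) := by
      refine (hcont.mono ?_).preimage_isClosed_of_isClosed hA isClosed_closure
      intro x hx
      exact norm_pos_iff.1 (hs₂.trans_le hx.1)
    refine (isCompact_closedBall (0 : EuclideanSpace ℝ (Fin N)) t₂).of_isClosed_subset hcl ?_
    intro x hx
    rw [mem_closedBall_zero_iff]
    exact hx.1.2
  obtain ⟨ρ, hρ, hsub⟩ := hK.exists_cthickening_subset_open hopen (by
    rintro x ⟨⟨a, b⟩, c⟩
    exact ⟨⟨norm_pos_iff.1 (hs₂.trans_le a), h21 c⟩, hs₁₂.trans_le a, b.trans_lt ht₂₁⟩)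
  refine ⟨ρ, hρ, ?_⟩
  intro R hR x hx hx1 hx2 z hz
  have hn : ∀ v : EuclideanSpace ℝ (Fin N), ‖R⁻¹ • v‖ = R⁻¹ * ‖v‖ := fun v => by
    rw [norm_smul, Real.norm_of_nonneg (by positivity)]
  have hdir : ∀ v : EuclideanSpace ℝ (Fin N), ‖R⁻¹ • v‖⁻¹ • (R⁻¹ • v) = ‖v‖⁻¹ • v := fun v => by
    rw [hn, smul_smul]
    congr 1
    field_simp
  have hzK : R⁻¹ • z ∈ {x : EuclideanSpace ℝ (Fin N) | x ∈ coneOf ω₁ ∧ s₁ < ‖x‖ ∧ ‖x‖ < t₁} := by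
    apply hsub
    refine Metric.mem_cthickening_of_dist_le (R⁻¹ • z) (R⁻¹ • x) ρ _ ?_ ?_
    · refine ⟨⟨?_, ?_⟩, ?_⟩
      · rw [hn, inv_mul_eq_div, le_div_iff₀ hR]
        exact hx1.le
      · rw [hn, inv_mul_eq_div, div_le_iff₀ hR]
        exact hx2.le
      · rw [hdir]
        exact subset_closure hx.2
    · rw [dist_eq_norm, ← smul_sub, hn, inv_mul_eq_div, div_le_iff₀ hR, ← dist_eq_norm]
      exact hz
  obtain ⟨⟨a, b⟩, c, d⟩ := hzK
  rw [hn, inv_mul_eq_div] at c d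
  rw [lt_div_iff₀ hR] at c
  rw [div_lt_iff₀ hR] at d
  rw [hdir] at b
  exact ⟨⟨fun h => a (by rw [h, smul_zero]), b⟩, c, d⟩

/-- Touching from below by a truncated paraboloid. -/
theorem touching {N : ℕ} (u : EuclideanSpace ℝ (Fin N) → ℝ) (hu : Continuous u)
    (hu0 : ∀ x, 0 ≤ u x) (x : EuclideanSpace ℝ (Fin N)) (r : ℝ) (hr : 0 < r)
    (hpos : ∀ z ∈ Metric.closedBall x r, 0 < u z) :
    ∃ z ∈ Metric.closedBall x r, ∀ y,
      -(2 * u x * min (‖y‖ ^ 2 / r ^ 2) 1) ≤ nlD u z y := by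
  set q : EuclideanSpace ℝ (Fin N) → ℝ := fun v => 1 - ‖v - x‖ ^ 2 / r ^ 2 with hq
  set φ : EuclideanSpace ℝ (Fin N) → ℝ := fun v => max 0 (q v) with hφ
  have hqc : Continuous q := by
    rw [hq]
    fun_prop
  have hφc : Continuous φ := continuous_const.max hqc
  obtain ⟨z, hz, hmin⟩ := (isCompact_closedBall x r).exists_isMinOn
    ⟨x, Metric.mem_closedBall_self hr.le⟩
    (f := fun v => u v - u x * φ v) (by fun_prop)
  have hqx : q x = 1 := by simp [hq]
  have hx0 : 0 ≤ u x := hu0 x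
  have hφx : φ x = 1 := by simp [hφ, hqx]
  have hwz : u z - u x * φ z ≤ 0 := by
    have := hmin (Metric.mem_closedBall_self hr.le : x ∈ Metric.closedBall x r)
    simp only [Set.mem_setOf_eq, hφx] at this
    linarith
  have hglob : ∀ v, u z - u x * φ z ≤ u v - u x * φ v := by
    intro v
    by_cases hv : v ∈ Metric.closedBall x r
    · exact hmin hv
    · have hv' : r < ‖v - x‖ := by
        rw [Metric.mem_closedBall, dist_eq_norm] at hv
        linarith
      have : q v ≤ 0 := by
        have : 1 ≤ ‖v - x‖ ^ 2 / r ^ 2 := by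
          rw [le_div_iff₀ (by positivity)]
          nlinarith
        simp only [hq]
        linarith
      have : φ v = 0 := max_eq_left this
      rw [this]
      linarith [hu0 v]
  have hqz : 0 < q z := by
    by_contra hcon
    have : φ z = 0 := max_eq_left (not_lt.1 hcon)
    rw [this] at hwz
    linarith [hpos z hz]
  have hφz : φ z = q z := max_eq_right hqz.le
  refine ⟨z, hz, fun y => ?_⟩
  have h1 := hglob (z + y)
  have h2 := hglob (z - y)
  have hD : u x * (φ (z + y) + φ (z - y) - 2 * φ z) ≤ nlD u z y := by
    unfold nlD
    linarith
  have hφD : -(2 * min (‖y‖ ^ 2 / r ^ 2) 1) ≤ φ (z + y) + φ (z - y) - 2 * φ z := by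
    rcases min_choice (‖y‖ ^ 2 / r ^ 2) 1 with h | h <;> rw [h]
    · have a1 : q (z + y) ≤ φ (z + y) := le_max_right _ _
      have a2 : q (z - y) ≤ φ (z - y) := le_max_right _ _
      have a3 : q (z + y) + q (z - y) - 2 * q z = -(2 * (‖y‖ ^ 2 / r ^ 2)) := by
        have par := parallelogram_law_with_norm ℝ (z - x) y
        have e1 : z + y - x = z - x + y := by abel
        have e2 : z - y - x = z - x - y := by abel
        simp only [hq, e1, e2]
        field_simp
        linarith
      linarith
    · have a1 : 0 ≤ φ (z + y) := le_max_left _ _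
      have a2 : 0 ≤ φ (z - y) := le_max_left _ _
      have a3 : q z ≤ 1 := by
        simp only [hq]
        have : 0 ≤ ‖z - x‖ ^ 2 / r ^ 2 := by positivity
        linarith
      linarith
  have := mul_le_mul_of_nonneg_left hφD hx0
  linarith

/-- Quantitative infimum estimate for supersolutions of the Lane–Emden
inequality in cones (Lemma 4.3). -/
theorem inf_estimate_lane_emden_cones
    (N : ℕ) (hN : 2 ≤ N) (α l L : ℝ)
    (hα : α ∈ Set.Ioo (0 : ℝ) 1) (hl : 0 < l) (hlL : l ≤ L)
    (ω ω₁ ω₂ : Set (EuclideanSpace ℝ (Fin N)))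
    (hω_sub : ω ⊆ Metric.sphere (0 : EuclideanSpace ℝ (Fin N)) 1)
    (hω_open : IsOpen (Subtype.val ⁻¹' ω :
      Set (Metric.sphere (0 : EuclideanSpace ℝ (Fin N)) 1)))
    (hω₁_open : IsOpen (Subtype.val ⁻¹' ω₁ :
      Set (Metric.sphere (0 : EuclideanSpace ℝ (Fin N)) 1)))
    (hω₂_open : IsOpen (Subtype.val ⁻¹' ω₂ :
      Set (Metric.sphere (0 : EuclideanSpace ℝ (Fin N)) 1)))
    (hω₁_sub : ω₁ ⊆ Metric.sphere (0 : EuclideanSpace ℝ (Fin N)) 1)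
    (hω₂_sub : ω₂ ⊆ Metric.sphere (0 : EuclideanSpace ℝ (Fin N)) 1)
    (hω₂_ne : ω₂.Nonempty)
    (h21 : closure ω₂ ⊆ ω₁) (h1ω : closure ω₁ ⊆ ω)
    (hω_proper : ω ≠ Metric.sphere (0 : EuclideanSpace ℝ (Fin N)) 1)
    (s₁ s₂ t₂ t₁ : ℝ) (hs₁ : 0 < s₁) (hs₁₂ : s₁ < s₂) (hst : s₂ < t₂) (ht₂₁ : t₂ < t₁) :
    ∃ C : ℝ, 0 < C ∧
      ∀ (p : ℝ) (R : ℝ), 0 < R →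
        ∀ u : EuclideanSpace ℝ (Fin N) → ℝ, Continuous u →
          (∀ x, 0 ≤ u x) → (∀ x ∈ coneOf ω, 0 < u x) →
          (∀ x ∈ coneOf ω,
            Integrable (fun y => Sminus l L (nlD u x y) * ‖y‖ ^ (-((N : ℝ) + 2 * α))) ∧
            ∫ y, Sminus l L (nlD u x y) * ‖y‖ ^ (-((N : ℝ) + 2 * α)) ≤ -(u x ^ p)) →
          sInf ((fun x => u x ^ p) ''
              {x | x ∈ coneOf ω₁ ∧ s₁ * R < ‖x‖ ∧ ‖x‖ < t₁ * R})
            ≤ C * R ^ (-(2 * α)) *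
              sInf (u '' {x | x ∈ coneOf ω₂ ∧ s₂ * R < ‖x‖ ∧ ‖x‖ < t₂ * R}) := by
  obtain ⟨ρ, hρ, hball⟩ := annulus_ball ω₁ ω₂ hω₁_open h21 s₁ s₂ t₂ t₁ hs₁ hs₁₂ ht₂₁
  have hL : 0 < L := hl.trans_le hlL
  set K : ℝ := ∫ y : EuclideanSpace ℝ (Fin N),
    min (‖y‖ ^ 2) 1 * ‖y‖ ^ (-((N : ℝ) + 2 * α)) with hKdef
  have hK0 : 0 ≤ K := integral_nonneg fun y => by positivity
  have hρα : 0 < ρ ^ (-(2 * α)) := Real.rpow_pos_of_pos hρ _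
  refine ⟨L * 2 * K * ρ ^ (-(2 * α)) + 1, by positivity, ?_⟩
  intro p R hR u hu hu0 hupos hsuper
  have hRα : 0 < R ^ (-(2 * α)) := Real.rpow_pos_of_pos hR _
  have hC : 0 < (L * 2 * K * ρ ^ (-(2 * α)) + 1) * R ^ (-(2 * α)) := by positivity
  rw [← div_le_iff₀' hC]
  have hs₂ : 0 < s₂ := hs₁.trans hs₁₂
  apply le_csInf
  · obtain ⟨e, he⟩ := hω₂_ne
    have hne : ‖e‖ = 1 := mem_sphere_zero_iff_norm.1 (hω₂_sub he)
    have hm : 0 < (s₂ + t₂) / 2 * R := by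
      have : 0 < s₂ + t₂ := by linarith
      positivity
    have hnn : ‖((s₂ + t₂) / 2 * R) • e‖ = (s₂ + t₂) / 2 * R := by
      rw [norm_smul, Real.norm_of_nonneg hm.le, hne, mul_one]
    refine ⟨_, ((s₂ + t₂) / 2 * R) • e, ⟨⟨?_, ?_⟩, ?_, ?_⟩, rfl⟩
    · rw [← norm_pos_iff, hnn]
      exact hm
    · rw [hnn, smul_smul, inv_mul_cancel₀ hm.ne', one_smul]
      exact he
    · rw [hnn]
      exact mul_lt_mul_of_pos_right (by linarith) hR
    · rw [hnn]
      exact mul_lt_mul_of_pos_right (by linarith) hR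
  · rintro _ ⟨x, ⟨hx, hx1, hx2⟩, rfl⟩
    rw [div_le_iff₀' hC]
    have hb := hball R hR x hx hx1 hx2
    have hr : 0 < ρ * R := by positivity
    have hcone : ∀ z ∈ Metric.closedBall x (ρ * R), z ∈ coneOf ω := fun z hz =>
      ⟨(hb z hz).1.1, h1ω (subset_closure (hb z hz).1.2)⟩
    obtain ⟨z, hz, hδ⟩ := touching u hu hu0 x (ρ * R) hr fun z hz => hupos z (hcone z hz)
    obtain ⟨hint, hle⟩ := hsuper z (hcone z hz)
    obtain ⟨hki, hkv⟩ := kernel_scale N hN α hα (ρ * R) hr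
    have hmono : ∫ y : EuclideanSpace ℝ (Fin N), -(L * 2 * u x) *
        (min (‖y‖ ^ 2 / (ρ * R) ^ 2) 1 * ‖y‖ ^ (-((N : ℝ) + 2 * α))) ≤
        ∫ y, Sminus l L (nlD u z y) * ‖y‖ ^ (-((N : ℝ) + 2 * α)) := by
      refine integral_mono (hki.const_mul _) hint fun y => ?_
      have hc : 0 ≤ 2 * u x * min (‖y‖ ^ 2 / (ρ * R) ^ 2) 1 := by
        have := hu0 x
        positivity
      have h1 := Sminus_lower l L _ _ hl hlL hc (hδ y)
      have h2 : 0 ≤ ‖y‖ ^ (-((N : ℝ) + 2 * α)) := by positivity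
      have h3 := mul_le_mul_of_nonneg_right h1 h2
      simp only
      linarith
    rw [integral_const_mul, hkv, Real.mul_rpow hρ.le hR.le] at hmono
    have hz1 : sInf ((fun x => u x ^ p) ''
        {x | x ∈ coneOf ω₁ ∧ s₁ * R < ‖x‖ ∧ ‖x‖ < t₁ * R}) ≤ u z ^ p := by
      refine csInf_le ⟨0, ?_⟩ ⟨z, hb z hz, rfl⟩
      rintro _ ⟨v, _, rfl⟩
      exact Real.rpow_nonneg (hu0 v) p
    have hlast : 0 ≤ R ^ (-(2 * α)) * u x := mul_nonneg hRα.le (hu0 x)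
    linarith
end

section
/- Growth and unboundedness of supersolutions for nonpositive powers (Lemma 4.3(ii); final assertion of Theorem 1.3). In the setting of Lemma 4.3 (same N, α, λ, Λ, ω, ω₁, ω₂, s₁ < s₂ < t₂ < t₁), fix p ≤ 0. Then there exists c > 0, depending only on N, α, λ, Λ, p, the ω_i, s_i, t_i, such that every continuous u : ℝ^N → ℝ with u ≥ 0 on ℝ^N, u > 0 on C_ω, satisfying for each x ∈ C_ω that y ↦ S₋(δ(u,x,y)) |y|^{−(N+2α)} is Lebesgue integrable with integral ≤ −u(x)^p, obeys inf{ u(x) : x ∈ C_{ω₂}, s₂R < |x| < t₂R } ≥ c R^{2α/(1−p)} for every R > 0. In particular every such supersolution u is unbounded on C_ω. -/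
open MeasureTheory

open Set in
lemma g_integrable (N : ℕ) (hN : 2 ≤ N) (α : ℝ) (hα : α ∈ Set.Ioo (0 : ℝ) 1) :
    Integrable (fun y : EuclideanSpace ℝ (Fin N) =>
      min 2 (4 * ‖y‖ ^ 2) * ‖y‖ ^ (-((N : ℝ) + 2 * α))) := by
  have : Nontrivial (EuclideanSpace ℝ (Fin N)) := by
    have : Nonempty (Fin N) := ⟨⟨0, by omega⟩⟩
    infer_instance
  rw [integrable_fun_norm_addHaar volume
    (f := fun t : ℝ => min 2 (4 * t ^ 2) * t ^ (-((N : ℝ) + 2 * α)))]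
  simp only [finrank_euclideanSpace, Fintype.card_fin, smul_eq_mul]
  obtain ⟨h0, h1⟩ := hα
  have key : ∀ t : ℝ, 0 < t → ∀ k : ℝ, t ^ (N - 1) * (t ^ k * t ^ (-((N : ℝ) + 2 * α)))
      = t ^ (k - 1 - 2 * α) := by
    intro t ht k
    rw [← Real.rpow_natCast, ← Real.rpow_add ht, ← Real.rpow_add ht, Nat.cast_sub (by omega)]
    congr 1
    push_cast
    ring
  have hmeas : Measurable (fun t : ℝ =>
      t ^ (N - 1) * (min 2 (4 * t ^ 2) * t ^ (-((N : ℝ) + 2 * α)))) := by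
    fun_prop
  rw [← Ioc_union_Ioi_eq_Ioi (zero_le_one : (0 : ℝ) ≤ 1)]
  apply IntegrableOn.union
  · have hI : IntegrableOn (fun t : ℝ => 4 * t ^ (2 - 1 - 2 * α)) (Ioc 0 1) := by
      rw [← intervalIntegrable_iff_integrableOn_Ioc_of_le zero_le_one]
      exact (intervalIntegral.intervalIntegrable_rpow' (by linarith)).const_mul 4
    refine Integrable.mono' hI hmeas.aestronglyMeasurable ?_
    refine (ae_restrict_iff' measurableSet_Ioc).2 (Filter.Eventually.of_forall ?_)
    rintro t ⟨ht, -⟩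
    rw [Real.norm_of_nonneg (by positivity), ← key t ht 2, Real.rpow_two]
    have := min_le_right 2 (4 * t ^ 2)
    calc _ ≤ t ^ (N - 1) * ((4 * t ^ 2) * t ^ (-((N : ℝ) + 2 * α))) := by gcongr
      _ = _ := by ring
  · have hI : IntegrableOn (fun t : ℝ => 2 * t ^ (0 - 1 - 2 * α)) (Ioi 1) :=
      (integrableOn_Ioi_rpow_of_lt (by linarith) zero_lt_one).const_mul 2
    refine Integrable.mono' hI hmeas.aestronglyMeasurable ?_
    refine (ae_restrict_iff' measurableSet_Ioi).2 (Filter.Eventually.of_forall ?_)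
    intro t ht
    have ht : 0 < t := lt_trans zero_lt_one ht
    rw [Real.norm_of_nonneg (by positivity), ← key t ht 0, Real.rpow_zero]
    have := min_le_left 2 (4 * t ^ 2)
    calc _ ≤ t ^ (N - 1) * (2 * t ^ (-((N : ℝ) + 2 * α))) := by gcongr
      _ = _ := by ring

lemma g_scaled (N : ℕ) (hN : 2 ≤ N) (α : ℝ) (hα : α ∈ Set.Ioo (0 : ℝ) 1) (r : ℝ) (hr : 0 < r) :
    Integrable (fun y : EuclideanSpace ℝ (Fin N) =>
      min 2 (4 * ‖y‖ ^ 2 / r ^ 2) * ‖y‖ ^ (-((N : ℝ) + 2 * α))) ∧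
    ∫ y : EuclideanSpace ℝ (Fin N), min 2 (4 * ‖y‖ ^ 2 / r ^ 2) * ‖y‖ ^ (-((N : ℝ) + 2 * α)) =
      r ^ (-(2 * α)) * ∫ y : EuclideanSpace ℝ (Fin N),
        min 2 (4 * ‖y‖ ^ 2) * ‖y‖ ^ (-((N : ℝ) + 2 * α)) := by
  set g := fun y : EuclideanSpace ℝ (Fin N) =>
      min 2 (4 * ‖y‖ ^ 2) * ‖y‖ ^ (-((N : ℝ) + 2 * α)) with hg
  have e : (fun y : EuclideanSpace ℝ (Fin N) =>
      min 2 (4 * ‖y‖ ^ 2 / r ^ 2) * ‖y‖ ^ (-((N : ℝ) + 2 * α))) =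
      fun y => r ^ (-((N : ℝ) + 2 * α)) * g (r⁻¹ • y) := by
    funext y
    simp only [hg, norm_smul, norm_inv, Real.norm_of_nonneg hr.le]
    rw [Real.mul_rpow (by positivity) (by positivity), Real.inv_rpow hr.le]
    have : r ^ (-((N : ℝ) + 2 * α)) ≠ 0 := (Real.rpow_pos_of_pos hr _).ne'
    have e2 : 4 * ‖y‖ ^ 2 / r ^ 2 = 4 * (r⁻¹ * ‖y‖) ^ 2 := by field_simp
    rw [e2]
    field_simp
  rw [e]
  constructor
  · exact ((g_integrable N hN α hα).comp_smul (inv_ne_zero hr.ne')).const_mul _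
  · rw [integral_const_mul, Measure.integral_comp_inv_smul]
    rw [finrank_euclideanSpace, Fintype.card_fin, smul_eq_mul, ← mul_assoc,
      abs_of_pos (by positivity), ← Real.rpow_natCast r N, ← Real.rpow_add hr]
    congr 2
    ring

lemma coneOf_isOpen {N : ℕ} (ω : Set (EuclideanSpace ℝ (Fin N)))
    (hω_open : IsOpen (Subtype.val ⁻¹' ω :
      Set (Metric.sphere (0 : EuclideanSpace ℝ (Fin N)) 1))) : IsOpen (coneOf ω) := by
  obtain ⟨U, hU, hUe⟩ := isOpen_induced_iff.1 hω_open
  have : coneOf ω = {x : EuclideanSpace ℝ (Fin N) | x ≠ 0} ∩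
      ((fun x : EuclideanSpace ℝ (Fin N) => ‖x‖⁻¹ • x) ⁻¹' U) := by
    ext x
    simp only [coneOf, Set.mem_ofPred_eq, Set.mem_inter_iff, Set.mem_preimage]
    refine and_congr_right fun hx => ?_
    have hm : ‖x‖⁻¹ • x ∈ Metric.sphere (0 : EuclideanSpace ℝ (Fin N)) 1 := by
      simp [norm_smul, hx]
    exact ((Set.ext_iff.1 hUe) ⟨_, hm⟩).symm
  rw [this]
  refine ContinuousOn.isOpen_inter_preimage ?_ isOpen_ne hU
  exact (continuous_norm.continuousOn.inv₀ (fun x hx => norm_ne_zero_iff.2 hx)).smul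
    continuousOn_id

lemma coneOf_smul {N : ℕ} (ω : Set (EuclideanSpace ℝ (Fin N))) (x : EuclideanSpace ℝ (Fin N))
    (a : ℝ) (ha : 0 < a) (h : a • x ∈ coneOf ω) : x ∈ coneOf ω := by
  obtain ⟨h1, h2⟩ := h
  refine ⟨fun hx => h1 (by simp [hx]), ?_⟩
  rw [norm_smul, Real.norm_of_nonneg ha.le, smul_smul, mul_inv, mul_right_comm,
    inv_mul_cancel₀ ha.ne', one_mul] at h2
  exact h2

lemma cone_ball {N : ℕ} (ω ω₂ : Set (EuclideanSpace ℝ (Fin N)))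
    (hω_sub : ω ⊆ Metric.sphere (0 : EuclideanSpace ℝ (Fin N)) 1)
    (hω_open : IsOpen (Subtype.val ⁻¹' ω :
      Set (Metric.sphere (0 : EuclideanSpace ℝ (Fin N)) 1)))
    (h : closure ω₂ ⊆ ω) (s : ℝ) (hs : 0 < s) :
    ∃ ε > 0, ∀ R > 0, ∀ x ∈ coneOf ω₂, s * R < ‖x‖ → Metric.closedBall x (ε * R) ⊆ coneOf ω := by
  have hc : IsCompact (closure ω₂) :=
    (isCompact_sphere (0 : EuclideanSpace ℝ (Fin N)) 1).of_isClosed_subset isClosed_closure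
      (h.trans hω_sub)
  have hsub : closure ω₂ ⊆ coneOf ω := by
    intro x hx
    have hn : ‖x‖ = 1 := by simpa using hω_sub (h hx)
    refine ⟨fun h0 => by simp [h0] at hn, by simpa [hn] using h hx⟩
  obtain ⟨ε, hε, hs2⟩ := hc.exists_cthickening_subset_open (coneOf_isOpen ω hω_open) hsub
  refine ⟨ε * s, by positivity, fun R hR x hx hxR z hz => ?_⟩
  have hx0 : 0 < ‖x‖ := norm_pos_iff.2 hx.1
  apply coneOf_smul ω z ‖x‖⁻¹ (by positivity)
  apply hs2
  refine Metric.mem_cthickening_of_dist_le _ (‖x‖⁻¹ • x) _ _ (subset_closure hx.2) ?_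
  rw [dist_smul₀, norm_inv, norm_norm, inv_mul_le_iff₀ hx0]
  have := Metric.mem_closedBall.1 hz
  nlinarith

lemma point_bound (N : ℕ) (hN : 2 ≤ N) (α l L : ℝ)
    (hα : α ∈ Set.Ioo (0 : ℝ) 1) (hl : 0 < l) (hlL : l ≤ L) (p : ℝ) (hp : p ≤ 0)
    (Ω : Set (EuclideanSpace ℝ (Fin N)))
    (u : EuclideanSpace ℝ (Fin N) → ℝ) (hu : Continuous u)
    (hu0 : ∀ x, 0 ≤ u x) (hpos : ∀ x ∈ Ω, 0 < u x)
    (hsol : ∀ x ∈ Ω,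
          Integrable (fun y => Sminus l L (nlD u x y) * ‖y‖ ^ (-((N : ℝ) + 2 * α))) ∧
          ∫ y, Sminus l L (nlD u x y) * ‖y‖ ^ (-((N : ℝ) + 2 * α)) ≤ -(u x ^ p))
    (x₀ : EuclideanSpace ℝ (Fin N)) (r : ℝ) (hr : 0 < r) (hball : Metric.closedBall x₀ r ⊆ Ω) :
    u x₀ ^ p ≤ L * u x₀ * (r ^ (-(2 * α)) * ∫ y : EuclideanSpace ℝ (Fin N),
        min 2 (4 * ‖y‖ ^ 2) * ‖y‖ ^ (-((N : ℝ) + 2 * α))) := by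
  have hL : 0 < L := hl.trans_le hlL
  have hm : 0 < u x₀ := hpos _ (hball (Metric.mem_closedBall_self hr.le))
  set m := u x₀ with hmdef
  set K := 2 * m / r ^ 2 with hK
  have hK0 : 0 < K := by positivity
  obtain ⟨z, hz, hzmin⟩ := (isCompact_closedBall x₀ r).exists_isMinOn
    ⟨x₀, Metric.mem_closedBall_self hr.le⟩
    (f := fun x => u x + K * ‖x - x₀‖ ^ 2) (by fun_prop)
  have hz0 : u z + K * ‖z - x₀‖ ^ 2 ≤ m := by
    have := hzmin (Metric.mem_closedBall_self hr.le)
    simpa using this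
  have hglob : ∀ x, u z + K * ‖z - x₀‖ ^ 2 ≤ u x + K * ‖x - x₀‖ ^ 2 := by
    intro x
    by_cases hx : x ∈ Metric.closedBall x₀ r
    · exact hzmin hx
    · rw [Metric.mem_closedBall, dist_eq_norm, not_le] at hx
      have h1 : r ^ 2 ≤ ‖x - x₀‖ ^ 2 := by gcongr
      have h2 : K * r ^ 2 = 2 * m := by rw [hK]; field_simp
      have := hu0 x
      nlinarith
  have huz : u z ≤ m := by nlinarith [sq_nonneg ‖z - x₀‖]
  have huzp : 0 < u z := hpos z (hball hz)
  have hδ : ∀ y, -(m * min 2 (4 * ‖y‖ ^ 2 / r ^ 2)) ≤ nlD u z y := by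
    intro y
    rw [mul_min_of_nonneg _ _ hm.le, neg_le, le_min_iff]
    unfold nlD
    constructor
    · have := hu0 (z + y); have := hu0 (z - y); linarith
    · have h1 := hglob (z + y)
      have h2 := hglob (z - y)
      have h3 := parallelogram_law_with_norm ℝ (z - x₀) y
      have e1 : z + y - x₀ = z - x₀ + y := by abel
      have e2 : z - y - x₀ = z - x₀ - y := by abel
      rw [e1] at h1
      rw [e2] at h2
      have h4 : m * (4 * ‖y‖ ^ 2 / r ^ 2) = 2 * K * ‖y‖ ^ 2 := by rw [hK]; ring
      rw [h4]
      nlinarith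
  have hS : ∀ y, -(L * m * min 2 (4 * ‖y‖ ^ 2 / r ^ 2)) ≤ Sminus l L (nlD u z y) := by
    intro y
    have h := hδ y
    have hg : 0 ≤ m * min 2 (4 * ‖y‖ ^ 2 / r ^ 2) := by positivity
    unfold Sminus
    have h1 : 0 ≤ l * max (nlD u z y) 0 := by positivity
    have h2 : max (-nlD u z y) 0 ≤ m * min 2 (4 * ‖y‖ ^ 2 / r ^ 2) := max_le (by linarith) hg
    nlinarith
  obtain ⟨hI, hle⟩ := hsol z (hball hz)
  obtain ⟨gI, ge⟩ := g_scaled N hN α hα r hr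
  have hint : ∫ y : EuclideanSpace ℝ (Fin N), -(L * m) *
      (min 2 (4 * ‖y‖ ^ 2 / r ^ 2) * ‖y‖ ^ (-((N : ℝ) + 2 * α))) ≤
      ∫ y, Sminus l L (nlD u z y) * ‖y‖ ^ (-((N : ℝ) + 2 * α)) := by
    refine integral_mono (gI.const_mul _) hI fun y => ?_
    have := mul_le_mul_of_nonneg_right (hS y)
      (Real.rpow_nonneg (norm_nonneg y) (-((N : ℝ) + 2 * α)))
    simp only
    linarith
  rw [integral_const_mul, ge] at hint
  have hpw : m ^ p ≤ u z ^ p := Real.rpow_le_rpow_of_nonpos huzp huz hp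
  linarith

lemma power_algebra (ε R α L I p m : ℝ) (hε : 0 < ε) (hR : 0 < R) (hL : 0 < L) (hI0 : 0 ≤ I)
    (hp : p ≤ 0) (hm : 0 < m)
    (key : m ^ p ≤ L * m * ((ε * R) ^ (-(2 * α)) * I)) :
    (ε ^ (2 * α) / (L * (I + 1))) ^ (1 / (1 - p)) * R ^ (2 * α / (1 - p)) ≤ m := by
  have hq : 0 < 1 - p := by linarith
  have hr : 0 < ε * R := by positivity
  have hA0 : 0 < ε ^ (2 * α) / (L * (I + 1)) := by positivity
  have h1 : ε ^ (2 * α) / (L * (I + 1)) * R ^ (2 * α) ≤ m ^ (1 - p) := by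
    have e : m ^ (1 - p) = m / m ^ p := by rw [Real.rpow_sub hm, Real.rpow_one]
    have hrp : 0 < (ε * R) ^ (2 * α) := by positivity
    rw [e, le_div_iff₀ (by positivity), div_mul_eq_mul_div, ← Real.mul_rpow hε.le hR.le,
      div_mul_eq_mul_div, div_le_iff₀ (by positivity)]
    rw [Real.rpow_neg hr.le] at key
    generalize (ε * R) ^ (2 * α) = B at *
    calc B * m ^ p
        ≤ B * (L * m * (B⁻¹ * I)) := by gcongr
      _ = L * m * I := by field_simp
      _ ≤ m * (L * (I + 1)) := by nlinarith [mul_pos hL hm]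
  have h2 := Real.rpow_le_rpow (by positivity) h1 (by positivity : 0 ≤ 1 / (1 - p))
  rw [← Real.rpow_mul hm.le, mul_one_div_cancel hq.ne', Real.rpow_one,
    Real.mul_rpow hA0.le (by positivity), ← Real.rpow_mul hR.le, mul_one_div] at h2
  exact h2

/-- Growth and unboundedness of supersolutions of the Lane–Emden inequality
in cones for nonpositive powers (Lemma 4.3(ii), Theorem 1.3). -/
theorem growth_unboundedness_nonpositive_powers
    (N : ℕ) (hN : 2 ≤ N) (α l L : ℝ)
    (hα : α ∈ Set.Ioo (0 : ℝ) 1) (hl : 0 < l) (hlL : l ≤ L)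
    (ω ω₁ ω₂ : Set (EuclideanSpace ℝ (Fin N)))
    (hω_sub : ω ⊆ Metric.sphere (0 : EuclideanSpace ℝ (Fin N)) 1)
    (hω_open : IsOpen (Subtype.val ⁻¹' ω :
      Set (Metric.sphere (0 : EuclideanSpace ℝ (Fin N)) 1)))
    (hω₁_open : IsOpen (Subtype.val ⁻¹' ω₁ :
      Set (Metric.sphere (0 : EuclideanSpace ℝ (Fin N)) 1)))
    (hω₂_open : IsOpen (Subtype.val ⁻¹' ω₂ :
      Set (Metric.sphere (0 : EuclideanSpace ℝ (Fin N)) 1)))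
    (hω₁_sub : ω₁ ⊆ Metric.sphere (0 : EuclideanSpace ℝ (Fin N)) 1)
    (hω₂_sub : ω₂ ⊆ Metric.sphere (0 : EuclideanSpace ℝ (Fin N)) 1)
    (hω₂_ne : ω₂.Nonempty)
    (h21 : closure ω₂ ⊆ ω₁) (h1ω : closure ω₁ ⊆ ω)
    (hω_proper : ω ≠ Metric.sphere (0 : EuclideanSpace ℝ (Fin N)) 1)
    (s₁ s₂ t₂ t₁ : ℝ) (hs₁ : 0 < s₁) (hs₁₂ : s₁ < s₂) (hst : s₂ < t₂) (ht₂₁ : t₂ < t₁)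
    (p : ℝ) (hp : p ≤ 0) :
    ∃ c : ℝ, 0 < c ∧
      ∀ u : EuclideanSpace ℝ (Fin N) → ℝ, Continuous u →
        (∀ x, 0 ≤ u x) → (∀ x ∈ coneOf ω, 0 < u x) →
        (∀ x ∈ coneOf ω,
          Integrable (fun y => Sminus l L (nlD u x y) * ‖y‖ ^ (-((N : ℝ) + 2 * α))) ∧
          ∫ y, Sminus l L (nlD u x y) * ‖y‖ ^ (-((N : ℝ) + 2 * α)) ≤ -(u x ^ p)) →
        (∀ R : ℝ, 0 < R →
          c * R ^ (2 * α / (1 - p))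
            ≤ sInf (u '' {x | x ∈ coneOf ω₂ ∧ s₂ * R < ‖x‖ ∧ ‖x‖ < t₂ * R})) ∧
        ¬ BddAbove (u '' coneOf ω) := by
  obtain ⟨ε, hε, hball⟩ := cone_ball ω ω₂ hω_sub hω_open
    (h21.trans (subset_closure.trans h1ω)) s₂ (hs₁.trans hs₁₂)
  have hα0 : 0 < α := hα.1
  have hs₂ : 0 < s₂ := hs₁.trans hs₁₂
  have hL : 0 < L := hl.trans_le hlL
  obtain ⟨I, hI⟩ : ∃ I : ℝ, I = ∫ y : EuclideanSpace ℝ (Fin N),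
        min 2 (4 * ‖y‖ ^ 2) * ‖y‖ ^ (-((N : ℝ) + 2 * α)) := ⟨_, rfl⟩
  have hI0 : 0 ≤ I := hI ▸ integral_nonneg fun y => by positivity
  have hq : 0 < 1 - p := by linarith
  obtain ⟨A, hA⟩ : ∃ A : ℝ, A = ε ^ (2 * α) / (L * (I + 1)) := ⟨_, rfl⟩
  have hA0 : 0 < A := by rw [hA]; positivity
  refine ⟨A ^ (1 / (1 - p)), by positivity, fun u hu hu0 hpos hsol => ?_⟩
  have hpt : ∀ R : ℝ, 0 < R → ∀ x ∈ coneOf ω₂, s₂ * R < ‖x‖ →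
      A ^ (1 / (1 - p)) * R ^ (2 * α / (1 - p)) ≤ u x := by
    intro R hR x hx hxR
    have hB := hball R hR x hx hxR
    have hr : 0 < ε * R := by positivity
    have hm : 0 < u x := hpos _ (hB (Metric.mem_closedBall_self hr.le))
    have key := point_bound N hN α l L hα hl hlL p hp (coneOf ω) u hu hu0 hpos hsol x (ε * R) hr hB
    rw [← hI] at key
    rw [hA]
    exact power_algebra ε R α L I p (u x) hε hR hL hI0 hp hm key
  obtain ⟨w, hw⟩ := hω₂_ne
  have hwn : ‖w‖ = 1 := by simpa using hω₂_sub hw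
  have hray : ∀ a : ℝ, 0 < a → a • w ∈ coneOf ω₂ ∧ ‖a • w‖ = a := by
    intro a ha
    have hn : ‖a • w‖ = a := by rw [norm_smul, hwn, Real.norm_of_nonneg ha.le, mul_one]
    refine ⟨⟨?_, ?_⟩, hn⟩
    · rw [← norm_ne_zero_iff, hn]; exact ha.ne'
    · rw [hn, smul_smul, inv_mul_cancel₀ ha.ne', one_smul]; exact hw
  constructor
  · intro R hR
    refine le_csInf ?_ ?_
    · have ha : 0 < (s₂ + t₂) / 2 * R := by
        have : 0 < s₂ + t₂ := by linarith
        positivity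
      obtain ⟨h1, h2⟩ := hray _ ha
      refine ⟨_, _, ⟨h1, ?_, ?_⟩, rfl⟩
      · rw [h2]; nlinarith
      · rw [h2]; nlinarith
    · rintro _ ⟨x, ⟨hx, hx1, -⟩, rfl⟩
      exact hpt R hR x hx hx1
  · rintro ⟨M, hM⟩
    have ht : Filter.Tendsto (fun R : ℝ => A ^ (1 / (1 - p)) * R ^ (2 * α / (1 - p)))
        Filter.atTop Filter.atTop :=
      (tendsto_rpow_atTop (by positivity)).const_mul_atTop (by positivity)
    obtain ⟨R, hRM, hR⟩ := ((ht.eventually_gt_atTop M).and (Filter.eventually_gt_atTop 0)).exists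
    obtain ⟨h1, h2⟩ := hray ((s₂ + 1) * R) (by positivity)
    have h3 := hpt R hR _ h1 (by rw [h2]; linarith [add_mul s₂ 1 R])
    have h4 := hM ⟨_, (⟨h1.1, h1ω (subset_closure (h21 (subset_closure h1.2)))⟩ :
      ((s₂ + 1) * R) • w ∈ coneOf ω), rfl⟩
    linarith
end

section
/- Concave powers of positive supersolutions are supersolutions (argument in the proof of Theorem 1.1). Let N ≥ 2, α ∈ (0,1), 0 < λ ≤ Λ, γ ∈ (0,1), and let v : ℝ^N → (0,∞). Then: (a) for all x, y ∈ ℝ^N the pointwise inequality δ(v^γ, x, y) ≤ γ v(x)^{γ−1} δ(v, x, y) holds, where v^γ(z) = v(z)^γ; (b) consequently, if at some point x the function y ↦ S₋(δ(v,x,y)) |y|^{−(N+2α)} is Lebesgue integrable with ∫_{ℝ^N} S₋(δ(v,x,y)) |y|^{−(N+2α)} dy ≤ 0, and y ↦ S₋(δ(v^γ,x,y)) |y|^{−(N+2α)} is Lebesgue integrable, then ∫_{ℝ^N} S₋(δ(v^γ,x,y)) |y|^{−(N+2α)} dy ≤ γ v(x)^{γ−1} ∫_{ℝ^N} S₋(δ(v,x,y))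 |y|^{−(N+2α)} dy ≤ 0. -/
open MeasureTheory

theorem rpow_tangent (γ a b : ℝ) (h0 : 0 < γ) (h1 : γ < 1) (ha : 0 < a) (hb : 0 < b) :
    b ^ γ ≤ a ^ γ + γ * a ^ (γ - 1) * (b - a) := by
  have hs : -1 ≤ b / a - 1 := by
    have : 0 < b / a := div_pos hb ha
    linarith
  have h := rpow_one_add_le_one_add_mul_self hs h0.le h1.le
  have e : 1 + (b / a - 1) = b / a := by ring
  rw [e, Real.div_rpow hb.le ha.le, div_le_iff₀ (Real.rpow_pos_of_pos ha γ)] at h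
  rw [Real.rpow_sub_one ha.ne']
  refine h.trans (le_of_eq ?_)
  field_simp

theorem Sminus_mono (l L s t : ℝ) (hl : 0 < l) (hlL : l ≤ L) (h : s ≤ t) :
    Sminus l L s ≤ Sminus l L t := by
  unfold Sminus
  have hL : 0 ≤ L := hl.le.trans hlL
  have h1 : max s 0 ≤ max t 0 := max_le_max_right 0 h
  have h2 : max (-t) 0 ≤ max (-s) 0 := max_le_max_right 0 (neg_le_neg h)
  have := mul_le_mul_of_nonneg_left h1 hl.le
  have := mul_le_mul_of_nonneg_left h2 hL
  linarith

theorem Sminus_smul (l L c t : ℝ) (hc : 0 ≤ c) :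
    Sminus l L (c * t) = c * Sminus l L t := by
  unfold Sminus
  have h1 : max (c * t) 0 = c * max t 0 := by
    rw [mul_max_of_nonneg _ _ hc, mul_zero]
  have h2 : max (-(c * t)) 0 = c * max (-t) 0 := by
    rw [mul_max_of_nonneg _ _ hc, mul_zero, mul_neg]
  rw [h1, h2]
  ring

/-- Concave powers of positive supersolutions are supersolutions
(argument in the proof of Theorem 1.1). -/
theorem concave_power_supersolution
    (N : ℕ) (hN : 2 ≤ N) (α l L γ : ℝ)
    (hα : α ∈ Set.Ioo (0 : ℝ) 1) (hl : 0 < l) (hlL : l ≤ L)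
    (hγ : γ ∈ Set.Ioo (0 : ℝ) 1)
    (v : EuclideanSpace ℝ (Fin N) → ℝ) (hv : ∀ z, 0 < v z) :
    (∀ x y : EuclideanSpace ℝ (Fin N),
      nlD (fun z => v z ^ γ) x y ≤ γ * v x ^ (γ - 1) * nlD v x y) ∧
    (∀ x : EuclideanSpace ℝ (Fin N),
      Integrable (fun y => Sminus l L (nlD v x y) * ‖y‖ ^ (-((N : ℝ) + 2 * α))) →
      ∫ y, Sminus l L (nlD v x y) * ‖y‖ ^ (-((N : ℝ) + 2 * α)) ≤ 0 →
      Integrable (fun y =>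
        Sminus l L (nlD (fun z => v z ^ γ) x y) * ‖y‖ ^ (-((N : ℝ) + 2 * α))) →
      (∫ y, Sminus l L (nlD (fun z => v z ^ γ) x y) * ‖y‖ ^ (-((N : ℝ) + 2 * α))
          ≤ γ * v x ^ (γ - 1)
            * ∫ y, Sminus l L (nlD v x y) * ‖y‖ ^ (-((N : ℝ) + 2 * α))) ∧
      γ * v x ^ (γ - 1)
          * (∫ y, Sminus l L (nlD v x y) * ‖y‖ ^ (-((N : ℝ) + 2 * α))) ≤ 0) := by
  have key : ∀ x y : EuclideanSpace ℝ (Fin N),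
      nlD (fun z => v z ^ γ) x y ≤ γ * v x ^ (γ - 1) * nlD v x y := by
    intro x y
    have h1 := rpow_tangent γ (v x) (v (x + y)) hγ.1 hγ.2 (hv _) (hv _)
    have h2 := rpow_tangent γ (v x) (v (x - y)) hγ.1 hγ.2 (hv _) (hv _)
    simp only [nlD]
    linarith
  refine ⟨key, fun x hi hle hi' => ?_⟩
  have hc : 0 ≤ γ * v x ^ (γ - 1) := mul_nonneg hγ.1.le (Real.rpow_nonneg (hv x).le _)
  refine ⟨?_, mul_nonpos_of_nonneg_of_nonpos hc hle⟩
  rw [← integral_const_mul]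
  refine integral_mono hi' (hi.const_mul _) fun y => ?_
  have h := Sminus_mono l L _ _ hl hlL (key x y)
  rw [Sminus_smul l L _ _ hc] at h
  have := mul_le_mul_of_nonneg_right h (Real.rpow_nonneg (norm_nonneg y) (-((N : ℝ) + 2 * α)))
  simpa only [mul_assoc] using this
end

section
/- Truncation-at-the-origin estimate (inequality (4.6) in the proof of Lemma 4.2). Let N ≥ 2, α ∈ (0,1), let u : ℝ^N → ℝ be continuous with u ≥ 0, and let ε > 0. Define the truncation U : ℝ^N → ℝ by U(y) = u(y) for |y| ≥ ε and U(y) = u(ε y/|y|) for 0 < |y| < ε (and U(0) = u(ε e₁), say). Then there is a constant C = C(N, α) such that for every x with |x| ≥ 2ε: ∫_{ℝ^N} max(δ(U−u, x, y), 0) |y|^{−(N+2α)} dy ≤ C · (sup{ u(z) : |z| = ε }) · ε^N · |x|^{−(N+2α)}, the integral being taken in [0,∞]. (Note that (U−u)(x) = 0 and U−u is supported in the ball B_ε(0), so δ(U−u, x, y) = (U−u)(x+y) + (U−u)(x−y).) -/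
open MeasureTheory Classical

/-- Truncation of `u` at the origin: `U(y) = u(y)` for `|y| ≥ ε`, and
`U(y) = u(ε y/|y|)` for `0 < |y| < ε`, with `U(0) = u(ε e₁)`. -/
noncomputable def truncAtOrigin {N : ℕ} (u : EuclideanSpace ℝ (Fin N) → ℝ)
    (ε : ℝ) (e₁ : EuclideanSpace ℝ (Fin N)) (y : EuclideanSpace ℝ (Fin N)) : ℝ :=
  if ε ≤ ‖y‖ then u y else if y = 0 then u (ε • e₁) else u ((ε / ‖y‖) • y)

theorem trunc_sub_le {N : ℕ} (u : EuclideanSpace ℝ (Fin N) → ℝ) (hu : ∀ z, 0 ≤ u z)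
    (ε : ℝ) (hε : 0 < ε) (e : EuclideanSpace ℝ (Fin N)) (he : ‖e‖ = 1) (M : ℝ)
    (hM : ∀ z, ‖z‖ = ε → u z ≤ M) (z : EuclideanSpace ℝ (Fin N)) (hz : ‖z‖ < ε) :
    truncAtOrigin u ε e z - u z ≤ M := by
  have h0 := hu z
  unfold truncAtOrigin
  rw [if_neg (not_le.mpr hz)]
  split_ifs with h
  · have := hM (ε • e) (by rw [norm_smul, he, Real.norm_of_nonneg hε.le, mul_one])
    linarith
  · have hz0 : 0 < ‖z‖ := norm_pos_iff.mpr h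
    have := hM ((ε / ‖z‖) • z) (by
      rw [norm_smul, Real.norm_of_nonneg (by positivity)]; field_simp)
    linarith

theorem trunc_sub_eq {N : ℕ} (u : EuclideanSpace ℝ (Fin N) → ℝ)
    (ε : ℝ) (e : EuclideanSpace ℝ (Fin N)) (z : EuclideanSpace ℝ (Fin N)) (hz : ε ≤ ‖z‖) :
    truncAtOrigin u ε e z - u z = 0 := by
  unfold truncAtOrigin
  rw [if_pos hz, sub_self]

/-- Truncation-at-the-origin estimate (inequality (4.6) in the proof of
Lemma 4.2). -/
theorem truncation_at_origin_estimate
    (N : ℕ) (hN : 2 ≤ N) (α : ℝ) (hα : α ∈ Set.Ioo (0 : ℝ) 1) :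
    ∃ C : ℝ, 0 < C ∧
      ∀ u : EuclideanSpace ℝ (Fin N) → ℝ, Continuous u → (∀ z, 0 ≤ u z) →
        ∀ ε : ℝ, 0 < ε →
          ∀ x : EuclideanSpace ℝ (Fin N), 2 * ε ≤ ‖x‖ →
            ∫⁻ y, ENNReal.ofReal
                (max (nlD (fun z =>
                    truncAtOrigin u ε (EuclideanSpace.single (⟨0, by omega⟩ : Fin N) 1) z
                      - u z) x y) 0
                  * ‖y‖ ^ (-((N : ℝ) + 2 * α)))
              ≤ ENNReal.ofReal
                  (C * sSup (u '' Metric.sphere (0 : EuclideanSpace ℝ (Fin N)) ε)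
                    * ε ^ (N : ℕ) * ‖x‖ ^ (-((N : ℝ) + 2 * α))) := by
  set p : ℝ := (N : ℝ) + 2 * α with hp
  have hp0 : 0 < p := by have := hα.1; positivity
  set V : ℝ := (volume (Metric.ball (0 : EuclideanSpace ℝ (Fin N)) 1)).toReal with hV
  have hVt : volume (Metric.ball (0 : EuclideanSpace ℝ (Fin N)) 1) ≠ ⊤ :=
    measure_ball_lt_top.ne
  have hV0 : 0 < V := ENNReal.toReal_pos (Metric.measure_ball_pos volume _ one_pos).ne' hVt
  refine ⟨2 * V * 2 ^ p, by positivity, ?_⟩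
  intro u huc hu ε hε x hx
  set e : EuclideanSpace ℝ (Fin N) := EuclideanSpace.single (⟨0, by omega⟩ : Fin N) 1 with he
  have he1 : ‖e‖ = 1 := by simp [he]
  set M : ℝ := sSup (u '' Metric.sphere (0 : EuclideanSpace ℝ (Fin N)) ε) with hMdef
  have hbdd : BddAbove (u '' Metric.sphere (0 : EuclideanSpace ℝ (Fin N)) ε) :=
    ((isCompact_sphere _ _).image huc).bddAbove
  have hM : ∀ z, ‖z‖ = ε → u z ≤ M := fun z hz =>
    le_csSup hbdd ⟨z, by simpa using hz, rfl⟩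
  have hM0 : 0 ≤ M := (hu (ε • e)).trans
    (hM _ (by rw [norm_smul, he1, Real.norm_of_nonneg hε.le, mul_one]))
  have hx0 : 0 < ‖x‖ := by linarith
  set K : ℝ := M * (‖x‖ / 2) ^ (-p) with hK
  have hK0 : 0 ≤ K := by positivity
  have hvol : ∀ c : EuclideanSpace ℝ (Fin N),
      volume (Metric.ball c ε) = ENNReal.ofReal (ε ^ N * V) := by
    intro c
    rw [Measure.addHaar_ball_of_pos volume c hε, finrank_euclideanSpace_fin,
      ENNReal.ofReal_mul (by positivity), hV, ENNReal.ofReal_toReal hVt]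
  -- the kernel bound near the two balls
  have hker : ∀ y : EuclideanSpace ℝ (Fin N), ‖x‖ / 2 ≤ ‖y‖ → ‖y‖ ^ (-p) ≤ (‖x‖ / 2) ^ (-p) :=
    fun y hy => Real.rpow_le_rpow_of_nonpos (by positivity) hy (by linarith)
  have hwx : truncAtOrigin u ε e x - u x = 0 := trunc_sub_eq u ε e x (by linarith)
  have hpt : ∀ y : EuclideanSpace ℝ (Fin N),
      ENNReal.ofReal (max (nlD (fun z => truncAtOrigin u ε e z - u z) x y) 0 * ‖y‖ ^ (-p)) ≤
        (Metric.ball (-x) ε).indicator (fun _ => ENNReal.ofReal K) y +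
        (Metric.ball x ε).indicator (fun _ => ENNReal.ofReal K) y := by
    intro y
    have hr : 0 ≤ ‖y‖ ^ (-p) := by positivity
    have e1 : y ∈ Metric.ball (-x) ε ↔ ‖x + y‖ < ε := by
      rw [mem_ball_iff_norm, sub_neg_eq_add, add_comm]
    have e2 : y ∈ Metric.ball x ε ↔ ‖x - y‖ < ε := by
      rw [mem_ball_iff_norm, norm_sub_rev]
    have k1 : ‖x + y‖ < ε → ‖y‖ ^ (-p) ≤ (‖x‖ / 2) ^ (-p) := fun h => hker y (by
      have := norm_sub_le (x + y) y
      rw [add_sub_cancel_right] at this; linarith)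
    have k2 : ‖x - y‖ < ε → ‖y‖ ^ (-p) ≤ (‖x‖ / 2) ^ (-p) := fun h => hker y (by
      have := norm_add_le (x - y) y
      rw [sub_add_cancel] at this; linarith)
    have fin : ∀ a b : ℝ, a ≤ b → 0 ≤ b → ‖y‖ ^ (-p) ≤ (‖x‖ / 2) ^ (-p) →
        max a 0 * ‖y‖ ^ (-p) ≤ b * (‖x‖ / 2) ^ (-p) := fun a b hab hb h =>
      mul_le_mul (max_le hab hb) h hr hb
    simp only [nlD, hwx, Set.indicator_apply, e1, e2]
    by_cases h1 : ‖x + y‖ < ε <;> by_cases h2 : ‖x - y‖ < ε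
    · have a1 := trunc_sub_le u hu ε hε e he1 M hM _ h1
      have a2 := trunc_sub_le u hu ε hε e he1 M hM _ h2
      rw [if_pos h1, if_pos h2, ← ENNReal.ofReal_add hK0 hK0]
      refine ENNReal.ofReal_le_ofReal ((fin _ (M + M) (by linarith) (by linarith) (k1 h1)).trans ?_)
      rw [hK]; linarith
    · have a1 := trunc_sub_le u hu ε hε e he1 M hM _ h1
      have a2 := trunc_sub_eq u ε e _ (not_lt.mp h2)
      rw [if_pos h1, if_neg h2, add_zero]
      exact ENNReal.ofReal_le_ofReal (fin _ M (by linarith) hM0 (k1 h1))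
    · have a1 := trunc_sub_eq u ε e _ (not_lt.mp h1)
      have a2 := trunc_sub_le u hu ε hε e he1 M hM _ h2
      rw [if_neg h1, if_pos h2, zero_add]
      exact ENNReal.ofReal_le_ofReal (fin _ M (by linarith) hM0 (k2 h2))
    · have a1 := trunc_sub_eq u ε e _ (not_lt.mp h1)
      have a2 := trunc_sub_eq u ε e _ (not_lt.mp h2)
      rw [a1, a2]; simp
  refine (lintegral_mono hpt).trans (le_of_eq ?_)
  rw [lintegral_add_left (measurable_const.indicator Metric.isOpen_ball.measurableSet),
    lintegral_indicator_const Metric.isOpen_ball.measurableSet,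
    lintegral_indicator_const Metric.isOpen_ball.measurableSet, hvol, hvol,
    ← ENNReal.ofReal_mul hK0, ← ENNReal.ofReal_add (by positivity) (by positivity)]
  congr 1
  have : (‖x‖ / 2) ^ (-p) = 2 ^ p * ‖x‖ ^ (-p) := by
    rw [Real.div_rpow hx0.le (by norm_num), Real.rpow_neg (by norm_num : (0:ℝ) ≤ 2), div_inv_eq_mul,
      mul_comm]
  rw [hK, this]; ring
end

section
/- Small-support difference estimate (inequality (4.3) in the proof of Lemma 4.1). Let N ≥ 2, α ∈ (0,1), β ∈ (0, N), M₀ ≥ 0, ε > 0. Let h : ℝ^N → ℝ be measurable with h(z) = 0 for |z| ≥ ε and |h(z)| ≤ M₀ |z|^{−β} for 0 < |z| < ε. Then there is a constant C = C(N, α, β) such that for every x with |x| ≥ 4ε, the function y ↦ δ(h, x, y) |y|^{−(N+2α)} is Lebesgue integrable on ℝ^N and ∫_{ℝ^N} |δ(h, x, y)| |y|^{−(N+2α)} dy ≤ C M₀ ε^{N−β} |x|^{−(N+2α)}. (Note δ(h,x,y) = h(x+y) + h(x−y) since h(x) = 0.) -/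
open MeasureTheory

/-- The truncated power integrand. -/
noncomputable def truncPow (β ε : ℝ) : ℝ → ℝ := (Set.Iio ε).indicator (fun r => r ^ (-β))

lemma truncPow_radial (N : ℕ) (hN : 2 ≤ N) (β ε : ℝ) (hβ : β < N) (hε : 0 < ε) :
    IntegrableOn (fun r : ℝ => r ^ (N - 1) • truncPow β ε r) (Set.Ioi 0) ∧
    ∫ r in Set.Ioi (0 : ℝ), r ^ (N - 1) • truncPow β ε r
      = ε ^ ((N : ℝ) - β) / ((N : ℝ) - β) := by
  have hc : ((N - 1 : ℕ) : ℝ) = (N : ℝ) - 1 := by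
    rw [Nat.cast_sub (by omega)]; simp
  have hEq : Set.EqOn (fun r : ℝ => r ^ (N - 1) • truncPow β ε r)
      ((Set.Iio ε).indicator (fun r => r ^ ((N : ℝ) - β - 1))) (Set.Ioi 0) := by
    intro r hr
    have hr : 0 < r := hr
    by_cases h : r ∈ Set.Iio ε
    · simp only [truncPow, Set.indicator_of_mem h, smul_eq_mul]
      rw [← Real.rpow_natCast, ← Real.rpow_add hr, hc]
      congr 1; ring
    · simp [truncPow, Set.indicator_of_notMem h]
  have hset : Set.Ioi (0:ℝ) ∩ Set.Iio ε = Set.Ioo 0 ε := Set.Ioi_inter_Iio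
  have hii : IntervalIntegrable (fun r : ℝ => r ^ ((N : ℝ) - β - 1)) volume 0 ε :=
    intervalIntegral.intervalIntegrable_rpow' (by linarith)
  have hio : IntegrableOn (fun r : ℝ => r ^ ((N : ℝ) - β - 1)) (Set.Ioo 0 ε) :=
    ((intervalIntegrable_iff_integrableOn_Ioc_of_le hε.le).1 hii).mono_set Set.Ioo_subset_Ioc_self
  constructor
  · rw [integrableOn_congr_fun hEq measurableSet_Ioi, IntegrableOn,
      integrable_indicator_iff measurableSet_Iio, IntegrableOn,
      Measure.restrict_restrict measurableSet_Iio, Set.inter_comm, hset]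
    exact hio
  · rw [setIntegral_congr_fun measurableSet_Ioi hEq, setIntegral_indicator measurableSet_Iio, hset,
      ← integral_Ioc_eq_integral_Ioo, ← intervalIntegral.integral_of_le hε.le,
      integral_rpow (Or.inl (by linarith))]
    rw [Real.zero_rpow (by linarith)]
    simp

lemma truncPow_integral (N : ℕ) (hN : 2 ≤ N) (β ε : ℝ) (hβ : β < N) (hε : 0 < ε) :
    Integrable (fun z : EuclideanSpace ℝ (Fin N) => truncPow β ε ‖z‖) ∧
    ∫ z : EuclideanSpace ℝ (Fin N), truncPow β ε ‖z‖
      = N * volume.real (Metric.ball (0 : EuclideanSpace ℝ (Fin N)) 1) *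
        (ε ^ ((N : ℝ) - β) / ((N : ℝ) - β)) := by
  have : Nonempty (Fin N) := ⟨⟨0, by omega⟩⟩
  obtain ⟨h1, h2⟩ := truncPow_radial N hN β ε hβ hε
  constructor
  · rw [integrable_fun_norm_addHaar volume (f := truncPow β ε)]
    simpa using h1
  · rw [integral_fun_norm_addHaar volume (truncPow β ε)]
    rw [finrank_euclideanSpace_fin, h2]
    simp [mul_assoc]

lemma ptwise {N : ℕ} (p β ε M₀ : ℝ) (hp : 0 < p) (hM : 0 ≤ M₀) (hε : 0 < ε)
    (h : EuclideanSpace ℝ (Fin N) → ℝ)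
    (h0 : ∀ z, ε ≤ ‖z‖ → h z = 0)
    (hb : ∀ z, z ≠ 0 → ‖z‖ < ε → |h z| ≤ M₀ * ‖z‖ ^ (-β))
    (x y w : EuclideanSpace ℝ (Fin N)) (hx : 4 * ε ≤ ‖x‖) (hw : w ≠ 0)
    (hwy : ‖x‖ ≤ ‖w‖ + ‖y‖) :
    |h w| * ‖y‖ ^ (-p) ≤ M₀ * 2 ^ p * ‖x‖ ^ (-p) * truncPow β ε ‖w‖ := by
  by_cases hc : ‖w‖ < ε
  · have hx0 : 0 < ‖x‖ := by linarith
    have h1 : ‖y‖ ^ (-p) ≤ (‖x‖ / 2) ^ (-p) :=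
      Real.rpow_le_rpow_of_nonpos (by linarith) (by linarith) (by linarith)
    have h2 : (‖x‖ / 2) ^ (-p) = 2 ^ p * ‖x‖ ^ (-p) := by
      rw [Real.div_rpow hx0.le (by norm_num), Real.rpow_neg (by norm_num : (0:ℝ) ≤ 2)]
      field_simp
    have h3 : truncPow β ε ‖w‖ = ‖w‖ ^ (-β) := by
      simp [truncPow, hc]
    rw [h3]
    calc |h w| * ‖y‖ ^ (-p) ≤ (M₀ * ‖w‖ ^ (-β)) * (2 ^ p * ‖x‖ ^ (-p)) := by
          rw [← h2]
          exact mul_le_mul (hb w hw hc) h1 (by positivity) (by positivity)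
      _ = _ := by ring
  · rw [h0 w (not_lt.1 hc)]
    simp [truncPow, hc]

/-- Small-support difference estimate (inequality (4.3) in the proof of
Lemma 4.1). -/
theorem small_support_difference_estimate
    (N : ℕ) (hN : 2 ≤ N) (α β : ℝ)
    (hα : α ∈ Set.Ioo (0 : ℝ) 1) (hβ : β ∈ Set.Ioo (0 : ℝ) (N : ℝ)) :
    ∃ C : ℝ, 0 < C ∧
      ∀ (M₀ ε : ℝ), 0 ≤ M₀ → 0 < ε →
        ∀ h : EuclideanSpace ℝ (Fin N) → ℝ, Measurable h →
          (∀ z, ε ≤ ‖z‖ → h z = 0) →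
          (∀ z, z ≠ 0 → ‖z‖ < ε → |h z| ≤ M₀ * ‖z‖ ^ (-β)) →
          ∀ x : EuclideanSpace ℝ (Fin N), 4 * ε ≤ ‖x‖ →
            Integrable (fun y => nlD h x y * ‖y‖ ^ (-((N : ℝ) + 2 * α))) ∧
            ∫ y, |nlD h x y| * ‖y‖ ^ (-((N : ℝ) + 2 * α))
              ≤ C * M₀ * ε ^ ((N : ℝ) - β) * ‖x‖ ^ (-((N : ℝ) + 2 * α)) := by
  obtain ⟨hα0, -⟩ := hα
  obtain ⟨-, hβN⟩ := hβ
  have hne : Nonempty (Fin N) := ⟨⟨0, by omega⟩⟩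
  have hN0 : (0 : ℝ) < N := by exact_mod_cast (by omega : 0 < N)
  have hp : 0 < (N : ℝ) + 2 * α := by linarith
  set p : ℝ := (N : ℝ) + 2 * α with hpdef
  set V : ℝ := volume.real (Metric.ball (0 : EuclideanSpace ℝ (Fin N)) 1) with hV
  have hVpos : 0 < V :=
    ENNReal.toReal_pos (Metric.measure_ball_pos volume _ one_pos).ne' measure_ball_lt_top.ne
  have hNβ : 0 < (N : ℝ) - β := by linarith
  refine ⟨2 * 2 ^ p * (N * V / (N - β)), by positivity, ?_⟩
  intro M₀ ε hM hε h hmeas h0 hb x hx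
  obtain ⟨gi, gI⟩ := truncPow_integral N hN β ε hβN hε
  set g : EuclideanSpace ℝ (Fin N) → ℝ := fun z => truncPow β ε ‖z‖ with hg
  set K : ℝ := M₀ * 2 ^ p * ‖x‖ ^ (-p) with hK
  have hx0 : h x = 0 := h0 x (by linarith)
  have gi1 : Integrable (fun y => g (x + y)) := gi.comp_add_left x
  have gi2 : Integrable (fun y => g (x - y)) := gi.comp_sub_left x
  have GI : Integrable (fun y => K * (g (x + y) + g (x - y))) := (gi1.add gi2).const_mul K
  have hae : ∀ᵐ y : EuclideanSpace ℝ (Fin N),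
      |nlD h x y| * ‖y‖ ^ (-p) ≤ K * (g (x + y) + g (x - y)) := by
    have e1 : ∀ᵐ y : EuclideanSpace ℝ (Fin N), y ≠ x := Measure.ae_ne volume x
    have e2 : ∀ᵐ y : EuclideanSpace ℝ (Fin N), y ≠ -x := Measure.ae_ne volume (-x)
    filter_upwards [e1, e2] with y hy1 hy2
    have a1 := ptwise p β ε M₀ hp hM hε h h0 hb x y (x + y) hx
      (fun hh => hy2 (eq_neg_of_add_eq_zero_right hh))
      (by simpa using norm_sub_le (x + y) y)
    have a2 := ptwise p β ε M₀ hp hM hε h h0 hb x y (x - y) hx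
      (fun hh => hy1 (sub_eq_zero.1 hh).symm)
      (by simpa using norm_add_le (x - y) y)
    have a3 : |nlD h x y| ≤ |h (x + y)| + |h (x - y)| := by
      simp only [nlD, hx0, mul_zero, sub_zero]
      exact abs_add_le _ _
    have a4 : 0 ≤ ‖y‖ ^ (-p) := by positivity
    calc |nlD h x y| * ‖y‖ ^ (-p) ≤ (|h (x + y)| + |h (x - y)|) * ‖y‖ ^ (-p) :=
          mul_le_mul_of_nonneg_right a3 a4
      _ ≤ K * (g (x + y) + g (x - y)) := by
          rw [add_mul, mul_add]; exact add_le_add a1 a2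
  have hm : Measurable (fun y => nlD h x y * ‖y‖ ^ (-p)) := by
    unfold nlD
    fun_prop
  have hInt : Integrable (fun y => nlD h x y * ‖y‖ ^ (-p)) := by
    refine GI.mono' hm.aestronglyMeasurable ?_
    filter_upwards [hae] with y hy
    rw [Real.norm_eq_abs, abs_mul, abs_of_nonneg (by positivity : 0 ≤ ‖y‖ ^ (-p))]
    exact hy
  refine ⟨hInt, ?_⟩
  have hIntAbs : Integrable (fun y => |nlD h x y| * ‖y‖ ^ (-p)) := by
    refine hInt.abs.congr (Filter.Eventually.of_forall fun y => ?_)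
    simp only [abs_mul]
    rw [abs_of_nonneg (by positivity : 0 ≤ ‖y‖ ^ (-p))]
  refine (integral_mono_ae hIntAbs GI hae).trans (le_of_eq ?_)
  rw [integral_const_mul, integral_add gi1 gi2, integral_add_left_eq_self g x,
    integral_sub_left_eq_self g volume x, gI, hK]
  field_simp
  ring
end
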